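/- arXiv:1108.4840 — 2 statements merged into one kernel-verified Lean document; each statement's English description precedes it below -/
import Mathlib

section
/- Let p be an odd prime with p ≡ 1, 2, 4, or 8 (mod 15), and set S = ∑_{k=0}^{⌊p/3⌋} C(3k,k)/3^k, with congruences interpreted in ℤ/pℤ. (i) If p ≡ 1 or 4 (mod 15) and p = x² + 15y² with x, y ∈ ℤ, then S ≡ 1 (mod p) if 3 | y, and S ≡ −(3x + 5y)/(10y) (mod p) if 3 | y − x. (ii) If p ≡ 2 or 8 (mod 15) and p = 5x² + 3y² with x, y ∈ ℤ, then S ≡ 1 (mod p) if 3 | y, and S ≡ (3x − y)/(2y) (mod p) if 3 | y − x. -/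
open Finset

lemma sq_eq_three_mul_add_one_of_prime {r : ℕ} (hr : r.Prime) (hr3 : r ≠ 3) :
    r ^ 2 = 3 * ((r ^ 2 - 1) / 3) + 1 := by
  have h3 : ¬ 3 ∣ r := fun h => hr3 ((Nat.prime_dvd_prime_iff_eq Nat.prime_three hr).mp h).symm
  have : r ^ 2 % 3 = 1 := by
    rw [Nat.pow_mod]
    have : r % 3 = 1 ∨ r % 3 = 2 := by omega
    rcases this with h | h <;> rw [h]
  omega

lemma even_sq_sub_one_div_three {r : ℕ} (hr : r.Prime) (hr2 : r ≠ 2) (hr3 : r ≠ 3) :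
    Even ((r ^ 2 - 1) / 3) := by
  have h := sq_eq_three_mul_add_one_of_prime hr hr3
  obtain ⟨b, hb⟩ := (hr.odd_of_ne_two hr2).pow (n := 2)
  rw [Nat.even_iff]
  omega

lemma gaussSum_pow_sq_sub_one {q : ℕ} [Fact q.Prime] {K : Type*} [Field K] {p : ℕ} [Fact p.Prime]
    [CharP K p] (hp3 : p ≠ 3) (hpq : p ≠ q) {χ : MulChar (ZMod q) K} (hχ : orderOf χ = 3)
    {ψ : AddChar (ZMod q) K} (hψ : ψ.IsPrimitive) :
    ((q : K) * jacobiSum χ χ) ^ ((p ^ 2 - 1) / 3) = χ p := by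
  have hp : p.Prime := Fact.out
  have hmod := sq_eq_three_mul_add_one_of_prime hp hp3
  have hχ3 : χ ^ 3 = 1 := hχ ▸ pow_orderOf_eq_one χ
  have hχ1 : χ ≠ 1 := by
    rintro rfl
    simp at hχ
  have hpq0 : (p : ZMod q) ≠ 0 := by
    rw [Ne, ZMod.natCast_eq_zero_iff, Nat.prime_dvd_prime_iff_eq Fact.out hp]
    exact fun h => hpq h.symm
  have hq0 : (Fintype.card (ZMod q) : K) ≠ 0 := by
    rw [ZMod.card, Ne, CharP.cast_eq_zero_iff K p, Nat.prime_dvd_prime_iff_eq hp Fact.out]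
    exact hpq
  have hval (a : ZMod q) (ha : a ≠ 0) : χ a ^ 3 = 1 := by
    rw [← MulChar.pow_apply' _ (by norm_num), hχ3, MulChar.one_apply (isUnit_iff_ne_zero.mpr ha)]
  have hneg : χ (-1) = 1 := by
    have h1 := hval (-1) (by simp)
    have h2 : χ (-1) ^ 2 = 1 := by rw [← map_pow]; simp
    linear_combination h1 - χ (-1) * h2
  have hg3 : gaussSum χ ψ ^ 3 = q * jacobiSum χ χ := by
    have := gaussSum_pow_eq_prod_jacobiSum (χ := χ) (ψ := ψ) (by omega) hψ
    rw [hχ, hneg, ZMod.card, one_mul] at this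
    simpa using this
  have hg0 := gaussSum_ne_zero_of_nontrivial hq0 hχ1 hψ
  have hfrob : χ p ^ 2 * gaussSum χ ψ ^ (p ^ 2) = gaussSum χ ψ := by
    have e : gaussSum χ ψ ^ (p ^ 2) = gaussSum χ (ψ.mulShift ((p : ZMod q) ^ 2)) := by
      have e1 : χ ^ (p ^ 2) = χ := by rw [hmod, pow_succ, pow_mul, hχ3, one_pow, one_mul]
      have e2 : ψ ^ (p ^ 2) = ψ.mulShift ((p : ZMod q) ^ 2) := by
        rw [AddChar.pow_mulShift]; push_cast; rfl
      rw [sq, pow_mul, gaussSum_frob, gaussSum_frob, ← pow_mul, ← pow_mul, ← sq, e1, e2]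
    have := gaussSum_mulShift χ ψ ((Units.mk0 (p : ZMod q) hpq0) ^ 2)
    rw [e, ← map_pow]
    simpa using this
  rw [← hg3, ← pow_mul]
  have h1 : χ p ^ 2 * gaussSum χ ψ ^ (3 * ((p ^ 2 - 1) / 3)) = 1 := by
    apply mul_right_cancel₀ hg0
    rw [mul_assoc, ← pow_succ, ← hmod, hfrob, one_mul]
  linear_combination χ p * h1 - gaussSum χ ψ ^ (3 * ((p ^ 2 - 1) / 3)) * hval p hpq0

lemma sum_choose_closed {K : Type*} [Field K] {s : K} (hs : s ^ 2 = 5) (h2 : (2 : K) ≠ 0) (n : ℕ) :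
    (∑ k ∈ range (n + 1), ((n + k).choose (2 * k) : K) * (-9) ^ k) * s =
      (-1) ^ n * (((1 + s) / 2) ^ (4 * n + 2) - ((1 - s) / 2) ^ (4 * n + 2)) := by
  set e := (1 + s) / 2 with he
  set e' := (1 - s) / 2 with he'
  have r1 : e ^ 2 = e + 1 := by rw [he]; field_simp; linear_combination hs
  have r2 : e' ^ 2 = e' + 1 := by rw [he']; field_simp; linear_combination hs
  have hse : e - e' = s := by rw [he, he']; field_simp; ring
  have key (n : ℕ) :
      (∑ k ∈ range (n + 1), ((n + k).choose (2 * k) : K) * (-9) ^ k) * s =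
        (-1) ^ n * (e ^ (4 * n + 2) - e' ^ (4 * n + 2)) ∧
      (∑ k ∈ range n, ((n + k).choose (2 * k + 1) : K) * (-9) ^ k) * s * 3 =
        (-1) ^ (n + 1) * (e ^ (4 * n) - e' ^ (4 * n)) := by
    induction n with
    | zero =>
      refine ⟨?_, by simp⟩
      simp
      linear_combination r2 - r1 - hse
    | succ n ih =>
      obtain ⟨ih1, ih2⟩ := ih
      have hB : ∑ k ∈ range (n + 1), ((n + 1 + k).choose (2 * k + 1) : K) * (-9) ^ k =
          (∑ k ∈ range n, ((n + k).choose (2 * k + 1) : K) * (-9) ^ k) +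
          ∑ k ∈ range (n + 1), ((n + k).choose (2 * k) : K) * (-9) ^ k := by
        have : ∑ k ∈ range n, ((n + k).choose (2 * k + 1) : K) * (-9) ^ k =
            ∑ k ∈ range (n + 1), ((n + k).choose (2 * k + 1) : K) * (-9) ^ k := by
          rw [sum_range_succ, Nat.choose_eq_zero_of_lt (by omega : n + n < 2 * n + 1)]
          simp
        rw [this, ← sum_add_distrib]
        refine sum_congr rfl fun k _ => ?_
        rw [show n + 1 + k = (n + k) + 1 by ring, Nat.choose_succ_succ]
        push_cast; ring
      have hA : ∑ k ∈ range (n + 1 + 1), ((n + 1 + k).choose (2 * k) : K) * (-9) ^ k =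
          (∑ k ∈ range (n + 1), ((n + k).choose (2 * k) : K) * (-9) ^ k) + (-9) *
          ∑ k ∈ range (n + 1), ((n + 1 + k).choose (2 * k + 1) : K) * (-9) ^ k := by
        have : ∑ k ∈ range (n + 1), ((n + k).choose (2 * k) : K) * (-9) ^ k =
            ∑ k ∈ range (n + 1 + 1), ((n + k).choose (2 * k) : K) * (-9) ^ k := by
          rw [sum_range_succ _ (n + 1),
            Nat.choose_eq_zero_of_lt (by omega : n + (n + 1) < 2 * (n + 1))]
          simp
        have e : ∑ k ∈ range (n + 1), ((n + 1 + (k + 1)).choose (2 * (k + 1)) : K) * (-9) ^ (k + 1) =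
            (∑ k ∈ range (n + 1), ((n + (k + 1)).choose (2 * (k + 1)) : K) * (-9) ^ (k + 1)) + (-9) *
            ∑ k ∈ range (n + 1), ((n + 1 + k).choose (2 * k + 1) : K) * (-9) ^ k := by
          rw [mul_sum, ← sum_add_distrib]
          refine sum_congr rfl fun k _ => ?_
          rw [show n + 1 + (k + 1) = (n + 1 + k) + 1 by ring,
            show 2 * (k + 1) = 2 * k + 1 + 1 by ring, Nat.choose_succ_succ,
            show n + (k + 1) = n + 1 + k by ring]
          push_cast; ring
        rw [this, sum_range_succ' _ (n + 1), sum_range_succ' _ (n + 1), e]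
        simp only [mul_zero, Nat.choose_zero_right]
        ring
      have p1 : e ^ 4 = 3 * e + 2 := by linear_combination (e ^ 2 + e + 2) * r1
      have p2 : e' ^ 4 = 3 * e' + 2 := by linear_combination (e' ^ 2 + e' + 2) * r2
      have q1 : e ^ (4 * n + 2) = e ^ (4 * n) * (e + 1) := by rw [pow_add, r1]
      have q2 : e' ^ (4 * n + 2) = e' ^ (4 * n) * (e' + 1) := by rw [pow_add, r2]
      have q3 : e ^ (4 * (n + 1)) = e ^ (4 * n) * (3 * e + 2) := by rw [mul_add, pow_add, mul_one, p1]
      have q4 : e' ^ (4 * (n + 1)) = e' ^ (4 * n) * (3 * e' + 2) := by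
        rw [mul_add, pow_add, mul_one, p2]
      have q5 : e ^ (4 * (n + 1) + 2) = e ^ (4 * n) * (8 * e + 5) := by
        rw [pow_add, q3]; linear_combination e ^ (4 * n) * (3 * e + 5) * r1
      have q6 : e' ^ (4 * (n + 1) + 2) = e' ^ (4 * n) * (8 * e' + 5) := by
        rw [pow_add, q4]; linear_combination e' ^ (4 * n) * (3 * e' + 5) * r2
      rw [q1, q2] at ih1
      rw [hA, hB, q3, q4, q5, q6]
      constructor
      · linear_combination -8 * ih1 - 3 * ih2
      · linear_combination 3 * ih1 + ih2
  exact (key n).1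

lemma choose_three_mul_succ (k : ℕ) :
    (3 * (k + 1)).choose (k + 1) * ((2 * k + 1) * (2 * k + 2)) =
      (3 * k).choose k * (3 * ((3 * k + 1) * (3 * k + 2))) := by
  have h1 := Nat.add_one_mul_choose_eq (3 * k + 2) k
  have h2 := Nat.choose_mul_succ_eq (3 * k + 1) k
  have h3 := Nat.choose_mul_succ_eq (3 * k) k
  rw [show 3 * k + 1 + 1 - k = 2 * k + 2 by omega] at h2
  rw [show 3 * k + 1 - k = 2 * k + 1 by omega] at h3
  have : (k + 1) * ((3 * (k + 1)).choose (k + 1) * ((2 * k + 1) * (2 * k + 2))) =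
      (k + 1) * ((3 * k).choose k * (3 * ((3 * k + 1) * (3 * k + 2)))) := by
    rw [show 3 * (k + 1) = 3 * k + 2 + 1 by ring]
    zify at h1 h2 h3 ⊢
    linear_combination -((2 * k + 1 : ℤ) * (2 * k + 2)) * h1 -
      3 * (k + 1 : ℤ) * (2 * k + 1) * h2 - 3 * (k + 1 : ℤ) * (3 * k + 2) * h3
  exact Nat.eq_of_mul_eq_mul_left (Nat.succ_pos k) this

lemma choose_add_succ {R : Type*} [CommRing R] (n k : ℕ) (h : k ≤ n) :
    ((n + (k + 1)).choose (2 * (k + 1)) : R) * ((2 * k + 1) * (2 * k + 2)) =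
      (n + k).choose (2 * k) * ((n + k + 1) * (n - k)) := by
  have h1 := Nat.add_one_mul_choose_eq (n + k) (2 * k + 1)
  have h2 := Nat.choose_succ_right_eq (n + k) (2 * k)
  rw [show n + k - 2 * k = n - k by omega] at h2
  replace h1 := congrArg (Nat.cast : ℕ → R) h1
  replace h2 := congrArg (Nat.cast : ℕ → R) h2
  push_cast [Nat.cast_sub h] at h1 h2
  rw [show n + (k + 1) = n + k + 1 by ring, show 2 * (k + 1) = 2 * k + 1 + 1 by ring]
  linear_combination -(2 * k + 1 : R) * h1 + (n + k + 1 : R) * h2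

lemma choose_three_mul_eq {K : Type*} [Field K] {p : ℕ} [CharP K p] (hp : p.Prime) (hp3 : p ≠ 3)
    (k : ℕ) (hk : k ≤ p / 3) :
    ((3 * k).choose k : K) = ((p / 3 + k).choose (2 * k) : K) * (-27) ^ k := by
  have hn : (3 * ((p / 3 : ℕ) : K) + 1) * (3 * ((p / 3 : ℕ) : K) + 2) = 0 := by
    have h3 : ¬ 3 ∣ p := fun h => hp3 ((Nat.prime_dvd_prime_iff_eq Nat.prime_three hp).mp h).symm
    have h : p = 3 * (p / 3) + 1 ∨ p = 3 * (p / 3) + 2 := by omega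
    have h0 := CharP.cast_eq_zero K p
    rw [mul_eq_zero]
    refine h.imp (fun h => ?_) fun h => ?_ <;> rw [h] at h0 <;> push_cast at h0 <;> exact h0
  induction k with
  | zero => simp
  | succ k ih =>
    have hlt : 2 * k + 2 < p := by omega
    have hne (m : ℕ) (h0 : 0 < m) (hm : m < p) : (m : K) ≠ 0 := by
      rw [Ne, CharP.cast_eq_zero_iff K p]
      exact Nat.not_dvd_of_pos_of_lt h0 hm
    have a1 : (2 * k + 1 : K) ≠ 0 := by exact_mod_cast hne (2 * k + 1) (by omega) (by omega)
    have a2 : (2 * k + 2 : K) ≠ 0 := by exact_mod_cast hne (2 * k + 2) (by omega) (by omega)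
    have c1 := congrArg (Nat.cast : ℕ → K) (choose_three_mul_succ k)
    have c2 := choose_add_succ (R := K) (p / 3) k (by omega)
    push_cast at c1
    rw [ih (by omega)] at c1
    apply mul_right_cancel₀ (mul_ne_zero a1 a2)
    rw [c1, pow_succ]
    linear_combination (-27) ^ k * 27 * c2 + 3 * ((p / 3 + k).choose (2 * k) : K) * (-27) ^ k * hn

lemma sum_choose_three_mul {K : Type*} [Field K] {p : ℕ} [CharP K p] (hp : p.Prime) (hp2 : p ≠ 2)
    (hp3 : p ≠ 3) {s : K} (hs : s ^ 2 = 5) :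
    (∑ k ∈ range (p / 3 + 1), ((3 * k).choose k : K) / 3 ^ k) * s =
      (-1) ^ (p / 3) * (((1 + s) / 2) ^ (4 * (p / 3) + 2) - ((1 - s) / 2) ^ (4 * (p / 3) + 2)) := by
  have hne (r : ℕ) (hr : r.Prime) (h : p ≠ r) : (r : K) ≠ 0 := by
    rwa [Ne, CharP.cast_eq_zero_iff K p, Nat.prime_dvd_prime_iff_eq hp hr]
  rw [← sum_choose_closed hs (by exact_mod_cast hne 2 Nat.prime_two hp2)]
  congr 1
  refine sum_congr rfl fun k hk => ?_
  have h3 : (3 : K) ≠ 0 := by exact_mod_cast hne 3 Nat.prime_three hp3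
  rw [choose_three_mul_eq hp hp3 k (by simpa [Nat.lt_succ_iff] using hk), mul_div_assoc,
    ← div_pow]
  congr 2
  field_simp
  norm_num

/-- The ring of Eisenstein integers, with `ω * ω = -1 - ω`. -/
abbrev EisensteinInt := QuadraticAlgebra ℤ (-1) (-1)

namespace EisensteinInt

open QuadraticAlgebra

lemma norm_eq (z : EisensteinInt) : z.norm = z.re ^ 2 - z.re * z.im + z.im ^ 2 := by
  rw [norm_def]; ring

lemma mul_star_self (z : EisensteinInt) : z * star z = (z.norm : EisensteinInt) := by
  rw [← algebraMap_norm_eq_mul_star]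
  exact eq_intCast (algebraMap ℤ _) _

lemma norm_nonneg (z : EisensteinInt) : 0 ≤ z.norm := by
  rw [norm_eq]; nlinarith [sq_nonneg (z.re - z.im), sq_nonneg z.re, sq_nonneg z.im]

lemma norm_eq_zero {z : EisensteinInt} (h : z.norm = 0) : z = 0 := by
  rw [norm_eq] at h
  have h1 : z.re ^ 2 = 0 := by
    nlinarith [sq_nonneg (z.re - z.im), sq_nonneg z.re, sq_nonneg z.im]
  have h2 : z.im ^ 2 = 0 := by
    nlinarith [sq_nonneg (z.re - z.im), sq_nonneg z.re, sq_nonneg z.im]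
  ext
  · simpa using h1
  · simpa using h2

instance : NoZeroDivisors EisensteinInt where
  eq_zero_or_eq_zero_of_mul_eq_zero {a b} h := by
    have := congrArg QuadraticAlgebra.norm h
    rw [map_mul, QuadraticAlgebra.norm_zero, mul_eq_zero] at this
    exact this.imp norm_eq_zero norm_eq_zero

instance : IsDomain EisensteinInt := NoZeroDivisors.to_isDomain _

lemma omega_relation : (ω : EisensteinInt) ^ 2 + ω + 1 = 0 := by
  ext <;> simp [sq]

lemma omega_pow_three : (ω : EisensteinInt) ^ 3 = 1 := by
  linear_combination (ω - 1) * omega_relation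

lemma star_omega : star (ω : EisensteinInt) = ω ^ 2 := by
  ext <;> simp [sq]

lemma star_intCast (n : ℤ) : star (n : EisensteinInt) = n := by
  ext <;> simp

lemma isPrimitiveRoot_omega : IsPrimitiveRoot (ω : EisensteinInt) 3 := by
  rw [IsPrimitiveRoot.iff_orderOf]
  exact orderOf_eq_prime omega_pow_three fun h => by simpa using congrArg (·.im) h

lemma eq_one_of_map_eq_one {F : Type*} [Field F] (h3 : (3 : F) ≠ 0) (φ : EisensteinInt →+* F)
    {u : EisensteinInt} (hu : u ^ 3 = 1) (hφ : φ u = 1) : u = 1 := by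
  by_contra h
  have : u ^ 2 + u + 1 = 0 := by
    refine (mul_eq_zero.mp (?_ : (u - 1) * (u ^ 2 + u + 1) = 0)).resolve_left (sub_ne_zero.mpr h)
    linear_combination hu
  apply h3
  have := congrArg φ this
  simp only [map_add, map_pow, hφ, map_one, map_zero] at this
  linear_combination this

lemma star_eq_sq {u : EisensteinInt} (hu : u ^ 3 = 1) : star u = u ^ 2 := by
  have hn : u.norm = 1 := by
    have h := congrArg QuadraticAlgebra.norm hu
    rw [map_pow, QuadraticAlgebra.norm_one] at h
    exact (pow_eq_one_iff_of_nonneg (norm_nonneg u) (by norm_num)).mp h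
  have h := mul_star_self u
  rw [hn, Int.cast_one] at h
  linear_combination u ^ 2 * h - star u * hu

/-- The ring homomorphism from the Eisenstein integers determined by a root of `X ^ 2 + X + 1`. -/
noncomputable def toRing {R : Type*} [CommRing R] (w : R) (hw : w ^ 2 + w + 1 = 0) :
    EisensteinInt →+* R :=
  (QuadraticAlgebra.lift ⟨w, by simp; linear_combination hw⟩ : EisensteinInt →ₐ[ℤ] R).toRingHom

/-- `α` has a rational cubic residue symbol: there is a character modulo the norm of `α` which, at
a prime `p`, is the cubic character of `α / star α` modulo `p`. -/
def HasCubicSymbol (α : EisensteinInt) : Prop :=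
  ∃ χ : ℤ →* EisensteinInt, (∀ n, IsCoprime n α.norm → χ n ^ 3 = 1) ∧
    (∀ m n, α.norm ∣ m - n → χ m = χ n) ∧
    ∀ p : ℕ, p.Prime → p ≠ 3 → IsCoprime (p : ℤ) α.norm →
      ∀ (F : Type) [Field F] [CharP F p] (φ : EisensteinInt →+* F),
        φ α ^ ((p ^ 2 - 1) / 3) = φ (χ p) * φ (star α) ^ ((p ^ 2 - 1) / 3)

lemma hasCubicSymbol_intCast (n : ℤ) : HasCubicSymbol n :=
  ⟨1, fun _ _ => by simp, fun _ _ _ => by simp, fun _ _ _ _ _ _ _ φ => by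
    rw [star_intCast]; simp⟩

lemma HasCubicSymbol.mul {α β : EisensteinInt} (hα : HasCubicSymbol α) (hβ : HasCubicSymbol β) :
    HasCubicSymbol (α * β) := by
  obtain ⟨χ, h1, h2, h3⟩ := hα
  obtain ⟨ψ, k1, k2, k3⟩ := hβ
  refine ⟨χ * ψ, fun n hn => ?_, fun m n h => ?_, fun p hp hp3 hc F _ _ φ => ?_⟩
  · rw [map_mul] at hn
    rw [MonoidHom.mul_apply, mul_pow, h1 n hn.of_mul_right_left, k1 n hn.of_mul_right_right,
      one_mul]
  · rw [map_mul] at h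
    rw [MonoidHom.mul_apply, MonoidHom.mul_apply, h2 m n (dvd_of_mul_right_dvd h),
      k2 m n (dvd_of_mul_left_dvd h)]
  · rw [map_mul] at hc
    have e1 := h3 p hp hp3 hc.of_mul_right_left F φ
    have e2 := k3 p hp hp3 hc.of_mul_right_right F φ
    rw [star_mul, map_mul, map_mul, MonoidHom.mul_apply, map_mul, mul_pow, mul_pow, e1, e2]
    ring

lemma HasCubicSymbol.star {α : EisensteinInt} (hα : HasCubicSymbol α) :
    HasCubicSymbol (star α) := by
  obtain ⟨χ, h1, h2, h3⟩ := hα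
  refine ⟨(starRingEnd EisensteinInt).toMonoidHom.comp χ, fun n hn => ?_, fun m n h => ?_,
    fun p hp hp3 hc F _ _ φ => ?_⟩
  · rw [QuadraticAlgebra.norm_star] at hn
    simp [← map_pow, h1 n hn]
  · rw [QuadraticAlgebra.norm_star] at h
    simp [h2 m n h]
  · rw [QuadraticAlgebra.norm_star] at hc
    simpa [starRingEnd_apply] using h3 p hp hp3 hc F (φ.comp (starRingEnd EisensteinInt))

lemma orderOf_ringHomComp {q p : ℕ} [Fact q.Prime] {χ : MulChar (ZMod q) EisensteinInt}
    (hχ : orderOf χ = 3) {F : Type*} [Field F] [CharP F p] (hp : p ≠ 3) (hp1 : p ≠ 1)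
    (φ : EisensteinInt →+* F) : orderOf (χ.ringHomComp φ) = 3 := by
  have hχ3 : χ ^ 3 = 1 := hχ ▸ pow_orderOf_eq_one χ
  have h3 : (3 : F) ≠ 0 := by
    have : ((3 : ℕ) : F) ≠ 0 := by
      rw [Ne, CharP.cast_eq_zero_iff F p, Nat.dvd_prime Nat.prime_three]
      tauto
    exact_mod_cast this
  have hval (a : ZMod q) (ha : IsUnit a) : χ a ^ 3 = 1 := by
    rw [← MulChar.pow_apply' _ (by norm_num), hχ3, MulChar.one_apply ha]
  refine orderOf_eq_prime ?_ fun h => ?_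
  · rw [MulChar.ringHomComp_pow, hχ3, MulChar.ringHomComp_one]
  · have : χ = 1 := MulChar.ext fun a => by
      rw [MulChar.one_apply_coe]
      refine eq_one_of_map_eq_one h3 φ (hval a a.isUnit) ?_
      rw [← MulChar.ringHomComp_apply, h, MulChar.one_apply_coe]
    simp [this] at hχ

lemma ringHomComp_star {q : ℕ} [Fact q.Prime] {χ : MulChar (ZMod q) EisensteinInt}
    (hχ : orderOf χ = 3) : χ.ringHomComp (starRingEnd EisensteinInt) = χ⁻¹ := by
  have hχ3 : χ ^ 3 = 1 := hχ ▸ pow_orderOf_eq_one χ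
  have h : χ⁻¹ = χ ^ 2 := inv_eq_of_mul_eq_one_right (by rw [← pow_succ', hχ3])
  refine MulChar.ext fun a => ?_
  rw [h, MulChar.ringHomComp_apply, starRingEnd_apply, star_eq_sq, MulChar.pow_apply_coe]
  rw [← MulChar.pow_apply_coe, hχ3, MulChar.one_apply_coe]

lemma exists_sq_add_self_add_one (K : Type*) [Field K] [IsAlgClosed K] :
    ∃ w : K, w ^ 2 + w + 1 = 0 := by
  obtain ⟨w, hw⟩ := IsAlgClosed.exists_root
    (Polynomial.X ^ 2 + Polynomial.X + 1 : Polynomial K) (by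
      rw [show (Polynomial.X ^ 2 + Polynomial.X + 1 : Polynomial K) =
        Polynomial.C 1 * Polynomial.X ^ 2 + Polynomial.C 1 * Polynomial.X + Polynomial.C 1 by simp,
        Polynomial.degree_quadratic one_ne_zero]
      norm_num)
  exact ⟨w, by simpa using hw⟩

lemma norm_jacobiSum {q : ℕ} [Fact q.Prime] {χ : MulChar (ZMod q) EisensteinInt}
    (hχ : orderOf χ = 3) : (jacobiSum χ χ).norm = q := by
  obtain ⟨w, hw⟩ := exists_sq_add_self_add_one ℂ
  let φ := toRing w hw
  have ho : orderOf (χ.ringHomComp φ) = 3 := orderOf_ringHomComp (p := 0) hχ (by simp) (by simp) φ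
  have h1 : χ.ringHomComp φ ≠ 1 := fun h => by simp [h] at ho
  have h2 : χ.ringHomComp φ * χ.ringHomComp φ ≠ 1 := fun h => by
    rw [← sq] at h
    have := orderOf_dvd_of_pow_eq_one h
    rw [ho] at this
    omega
  have hinv : (χ.ringHomComp φ)⁻¹ = (χ.ringHomComp (starRingEnd EisensteinInt)).ringHomComp φ := by
    rw [ringHomComp_star hχ, MulChar.ringHomComp_inv]
  have hchar : ringChar ℂ ≠ ringChar (ZMod q) := by
    rw [ringChar.eq_zero, ZMod.ringChar_zmod_n]
    exact (Fact.out : q.Prime).ne_zero.symm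
  have key := jacobiSum_mul_jacobiSum_inv hchar h1 h1 h2
  rw [hinv, jacobiSum_ringHomComp, jacobiSum_ringHomComp, jacobiSum_ringHomComp, ← map_mul,
    starRingEnd_apply, mul_star_self, map_intCast, ZMod.card] at key
  exact_mod_cast key

lemma three_dvd_jacobiSum_add_one {q : ℕ} [Fact q.Prime] {χ : MulChar (ZMod q) EisensteinInt}
    (hχ : orderOf χ = 3) : 3 ∣ jacobiSum χ χ + 1 := by
  have hχ3 : χ ^ 3 = 1 := hχ ▸ pow_orderOf_eq_one χ
  obtain ⟨z, -, hz⟩ := exists_jacobiSum_eq_neg_one_add (by norm_num) hχ3 hχ3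
    (hχ ▸ χ.orderOf_dvd_card_sub_one) isPrimitiveRoot_omega
  refine ⟨-ω * z, ?_⟩
  rw [hz]
  linear_combination z * omega_relation

lemma hasCubicSymbol_jacobiSum {q : ℕ} [Fact q.Prime] {χ : MulChar (ZMod q) EisensteinInt}
    (hχ : orderOf χ = 3) : HasCubicSymbol (jacobiSum χ χ) := by
  have hχ3 : χ ^ 3 = 1 := hχ ▸ pow_orderOf_eq_one χ
  refine ⟨(χ ^ 2).toMonoidHom.comp (Int.castRingHom (ZMod q)).toMonoidHom, fun n hn => ?_,
    fun m n h => ?_, fun p hp hp3 hc F _ _ φ => ?_⟩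
  · have hu : IsUnit (n : ZMod q) := by
      rw [norm_jacobiSum hχ] at hn
      simpa using (hn.map (Int.castRingHom (ZMod q)))
    change (χ ^ 2) (n : ZMod q) ^ 3 = 1
    rw [← MulChar.pow_apply' _ (by norm_num), pow_right_comm, hχ3, one_pow, MulChar.one_apply hu]
  · rw [norm_jacobiSum hχ] at h
    change (χ ^ 2) (m : ZMod q) = (χ ^ 2) (n : ZMod q)
    rw [(ZMod.intCast_eq_intCast_iff_dvd_sub n m q).mpr h]
  · have : Fact p.Prime := ⟨hp⟩
    have hpq : p ≠ q := by
      rintro rfl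
      rw [norm_jacobiSum hχ, isCoprime_self, Int.isUnit_iff] at hc
      have := hp.one_lt
      omega
    change _ = φ ((χ ^ 2) ((p : ℤ) : ZMod q)) * _
    let K := AlgebraicClosure F
    have : CharP K p := charP_of_injective_algebraMap (algebraMap F K).injective p
    let Φ : EisensteinInt →+* K := (algebraMap F K).comp φ
    apply (algebraMap F K).injective
    rw [map_mul, map_pow, map_pow]
    change Φ _ ^ _ = Φ _ * Φ _ ^ _
    have hq0 : ((q : ℕ) : K) ≠ 0 := by
      rw [Ne, CharP.cast_eq_zero_iff K p, Nat.prime_dvd_prime_iff_eq hp Fact.out]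
      exact hpq
    have : NeZero (q : K) := ⟨hq0⟩
    obtain ⟨ζ, hζ⟩ := HasEnoughRootsOfUnity.exists_primitiveRoot K q
    have hψ := AddChar.zmodChar_primitive_of_primitive_root q hζ
    have ho := orderOf_ringHomComp hχ hp3 hp.ne_one Φ
    have e1 := gaussSum_pow_sq_sub_one hp3 hpq ho hψ
    have e2 := gaussSum_pow_sq_sub_one hp3 hpq ((orderOf_inv _).trans ho) hψ
    have hinv : (χ.ringHomComp Φ)⁻¹ =
        (χ.ringHomComp (starRingEnd EisensteinInt)).ringHomComp Φ := by
      rw [ringHomComp_star hχ, MulChar.ringHomComp_inv]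
    rw [hinv, jacobiSum_ringHomComp, jacobiSum_ringHomComp, starRingEnd_apply, ← hinv,
      MulChar.inv_apply_eq_inv'] at e2
    rw [jacobiSum_ringHomComp] at e1
    rw [Int.cast_natCast, MulChar.pow_apply' _ two_ne_zero, map_pow, ← MulChar.ringHomComp_apply]
    have hc0 : χ.ringHomComp Φ p ≠ 0 := by
      refine (IsUnit.map (χ.ringHomComp Φ) (isUnit_iff_ne_zero.mpr ?_)).ne_zero
      rw [Ne, ZMod.natCast_eq_zero_iff, Nat.prime_dvd_prime_iff_eq Fact.out hp]
      exact fun h => hpq h.symm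
    apply mul_left_cancel₀ (pow_ne_zero ((p ^ 2 - 1) / 3) hq0)
    rw [← mul_pow, e1, mul_left_comm, ← mul_pow, e2]
    field_simp

lemma exists_norm_eq_of_prime {q : ℕ} (hq : q.Prime) (hq3 : q % 3 = 1) :
    ∃ J : EisensteinInt, J.norm = q ∧ 3 ∣ J + 1 ∧ HasCubicSymbol J := by
  have : Fact q.Prime := ⟨hq⟩
  obtain ⟨χ, hχ⟩ := MulChar.exists_mulChar_orderOf (ZMod q) (n := 3)
    (by rw [ZMod.card]; omega) isPrimitiveRoot_omega
  exact ⟨_, norm_jacobiSum hχ, three_dvd_jacobiSum_add_one hχ, hasCubicSymbol_jacobiSum hχ⟩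

lemma dvd_re_im_of_dvd_norm {q : ℕ} (hq : q.Prime) (hq3 : q % 3 = 2) {α : EisensteinInt}
    (h : (q : ℤ) ∣ α.norm) : (q : ℤ) ∣ α.re ∧ (q : ℤ) ∣ α.im := by
  have : Fact q.Prime := ⟨hq⟩
  rw [norm_eq] at h
  simp only [← ZMod.intCast_zmod_eq_zero_iff_dvd] at h ⊢
  push_cast at h
  have him : ((α.im : ℤ) : ZMod q) = 0 := by
    by_contra hb
    obtain ⟨w, hw⟩ : ∃ w : ZMod q, w * (α.im : ZMod q) = -(α.re : ZMod q) :=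
      ⟨_, div_mul_cancel₀ _ hb⟩
    have hw2 : w ^ 2 + w + 1 = 0 := by
      apply mul_right_cancel₀ (pow_ne_zero 2 hb)
      linear_combination h + (w * (α.im : ZMod q) - α.re + α.im) * hw
    have hw3 : w ^ 3 = 1 := by linear_combination (w - 1) * hw2
    have h3 : (3 : ZMod q) ≠ 0 := by
      have : ((3 : ℕ) : ZMod q) ≠ 0 := by
        rw [Ne, ZMod.natCast_eq_zero_iff, Nat.prime_dvd_prime_iff_eq hq Nat.prime_three]
        omega
      exact_mod_cast this
    have hw1 : w ≠ 1 := by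
      rintro rfl
      exact h3 (by linear_combination hw2)
    have hd := ZMod.orderOf_dvd_card_sub_one (a := w) (by rintro rfl; simp at hw3)
    rw [orderOf_eq_prime hw3 hw1] at hd
    omega
  refine ⟨?_, him⟩
  rw [him] at h
  simpa using h

lemma dvd_im_mul_or {q : ℕ} (hq : q.Prime) {α β : EisensteinInt} (hα : (q : ℤ) ∣ α.norm)
    (hβ : (q : ℤ) ∣ β.norm) : (q : ℤ) ∣ (α * β).im ∨ (q : ℤ) ∣ (α * star β).im := by
  have hp := Nat.prime_iff_prime_int.mp hq
  apply hp.dvd_or_dvd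
  have : (α * β).im * (α * star β).im = α.im ^ 2 * β.norm - β.im ^ 2 * α.norm := by
    simp [norm_eq]; ring
  rw [this]
  exact dvd_sub (hβ.mul_left _) (hα.mul_left _)

lemma intCast_dvd_of_dvd {n : ℤ} {α : EisensteinInt} (h1 : n ∣ α.re) (h2 : n ∣ α.im) :
    ∃ γ : EisensteinInt, α = n * γ := by
  obtain ⟨a, ha⟩ := h1
  obtain ⟨b, hb⟩ := h2
  exact ⟨⟨a, b⟩, by ext <;> simp [ha, hb]⟩

/-- If the prime `norm β` divides `norm α` and the second coordinate of `α * star β`,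
then `β` divides `α`. -/
lemma exists_eq_mul_of_dvd_im {q : ℕ} (hq : q.Prime) {α β : EisensteinInt}
    (hα : (q : ℤ) ∣ α.norm) (hβ : β.norm = q) (h : (q : ℤ) ∣ (α * star β).im) :
    ∃ γ, α = γ * β := by
  have hp := Nat.prime_iff_prime_int.mp hq
  have hre : (q : ℤ) ∣ (α * star β).re := by
    have hn : (q : ℤ) ∣ (α * star β).norm := by
      rw [map_mul]
      exact hα.mul_right _
    rw [norm_eq] at hn
    apply hp.dvd_of_dvd_pow (n := 2)
    obtain ⟨u, hu⟩ := h
    obtain ⟨v, hv⟩ := hn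
    exact ⟨v + u * (α * star β).re - u * (α * star β).im, by
      linear_combination hv + ((α * star β).re - (α * star β).im) * hu⟩
  obtain ⟨γ, hγ⟩ := intCast_dvd_of_dvd hre h
  refine ⟨γ, ?_⟩
  have hq0 : ((q : ℤ) : EisensteinInt) ≠ 0 := by
    exact_mod_cast hq.ne_zero
  apply mul_left_cancel₀ hq0
  have := mul_star_self β
  rw [hβ] at this
  linear_combination β * hγ - α * this

/-- Primary Eisenstein integers have a rational cubic residue symbol. -/
theorem hasCubicSymbol_of_primary (α : EisensteinInt) (him : 3 ∣ α.im) (hre : ¬ 3 ∣ α.re) :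
    HasCubicSymbol α := by
  induction hn : α.norm.natAbs using Nat.strong_induction_on generalizing α with
  | _ n ih =>
  have hα0 : α.norm ≠ 0 := fun h => hre (by rw [norm_eq_zero h]; simp)
  have hpos : 0 < α.norm := lt_of_le_of_ne (norm_nonneg α) hα0.symm
  by_cases h1 : n = 1
  · have hN : α.re ^ 2 - α.re * α.im + α.im ^ 2 = 1 := by rw [← norm_eq]; omega
    have him0 : α.im = 0 := by
      obtain ⟨k, hk⟩ := him
      rw [hk] at hN
      have hk1 : k ^ 2 < 1 := by nlinarith [sq_nonneg (2 * α.re - 3 * k)]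
      have : k = 0 := by rwa [sq_lt_one_iff_abs_lt_one, Int.abs_lt_one_iff] at hk1
      rw [hk, this, mul_zero]
    have : α = (α.re : EisensteinInt) := by ext <;> simp [him0]
    rw [this]
    exact hasCubicSymbol_intCast _
  have hq := Nat.minFac_prime h1
  set q := n.minFac with hqdef
  have hqn : (q : ℤ) ∣ α.norm := by
    rw [Int.natCast_dvd, hn]
    exact n.minFac_dvd
  have hlt (β γ : EisensteinInt) (hβ : 1 < β.norm) (h : α = γ * β) : γ.norm.natAbs < n := by
    have : α.norm = γ.norm * β.norm := by rw [h, map_mul]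
    have hγ : 0 < γ.norm := by nlinarith [norm_nonneg γ]
    have : γ.norm < α.norm := by nlinarith
    omega
  have hq1 : (1 : ℤ) < q := by exact_mod_cast hq.one_lt
  have hcases : q % 3 = 0 ∨ q % 3 = 1 ∨ q % 3 = 2 := by omega
  rcases hcases with h3 | h3 | h3
  · exfalso
    have h3n : (3 : ℤ) ∣ α.norm := dvd_trans (by omega) hqn
    rw [norm_eq] at h3n
    apply hre
    apply Int.prime_three.dvd_of_dvd_pow (n := 2)
    obtain ⟨k, hk⟩ := him
    obtain ⟨v, hv⟩ := h3n
    exact ⟨v + k * α.re - k * α.im, by linear_combination hv + (α.re - α.im) * hk⟩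
  · obtain ⟨β, hβn, hβ3, hβ, γ, hγ⟩ : ∃ β : EisensteinInt, β.norm = q ∧ 3 ∣ β + 1 ∧
        HasCubicSymbol β ∧ ∃ γ, α = γ * β := by
      obtain ⟨J, hJ1, hJ2, hJ3⟩ := exists_norm_eq_of_prime hq h3
      have hJs : (star J).norm = q := by rw [QuadraticAlgebra.norm_star, hJ1]
      rcases dvd_im_mul_or hq hqn (dvd_of_eq hJ1.symm) with h | h
      · refine ⟨star J, hJs, ?_, hJ3.star, ?_⟩
        · obtain ⟨δ, hδ⟩ := hJ2
          refine ⟨star δ, ?_⟩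
          have := congrArg star hδ
          rw [star_add, star_one, star_mul, show (3 : EisensteinInt) = ((3 : ℤ) : EisensteinInt) by
            norm_num, star_intCast] at this
          rw [this]
          push_cast
          ring
        · exact exists_eq_mul_of_dvd_im hq hqn hJs (by rwa [star_star])
      · exact ⟨J, hJ1, hJ2, hJ3, exists_eq_mul_of_dvd_im hq hqn hJ1 h⟩
    obtain ⟨δ, hδ⟩ := hβ3
    have hsum : α + γ = ((3 : ℤ) : EisensteinInt) * (δ * γ) := by
      push_cast
      linear_combination hγ + γ * hδ
    have e1 : α.re + γ.re = 3 * (δ * γ).re := by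
      have := congrArg (·.re) hsum
      simpa using this
    have e2 : α.im + γ.im = 3 * (δ * γ).im := by
      have := congrArg (·.im) hsum
      simpa using this
    rw [hγ]
    exact (ih _ (hlt β γ (by rw [hβn]; exact hq1) hγ) γ (by omega) (by omega) rfl).mul hβ
  · obtain ⟨hd1, hd2⟩ := dvd_re_im_of_dvd_norm hq h3 hqn
    obtain ⟨γ, hγ⟩ := intCast_dvd_of_dvd hd1 hd2
    have e1 : α.re = q * γ.re := by
      have := congrArg (·.re) hγ
      simpa using this
    have e2 : α.im = q * γ.im := by
      have := congrArg (·.im) hγ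
      simpa using this
    rw [mul_comm] at hγ
    rw [hγ]
    refine (ih _ (hlt _ γ ?_ hγ) γ ?_ ?_ rfl).mul (hasCubicSymbol_intCast _)
    · rw [QuadraticAlgebra.norm_intCast, Int.cast_id]; nlinarith
    · rw [e2] at him
      refine (Int.prime_three.dvd_or_dvd him).resolve_left ?_
      omega
    · intro h
      exact hre (e1 ▸ h.mul_left _)

lemma omega_pow_eq {a b : ℕ} (h : a % 3 = b % 3) : (ω : EisensteinInt) ^ a = ω ^ b := by
  rw [← pow_mod_orderOf, ← pow_mod_orderOf _ b, ← isPrimitiveRoot_omega.eq_orderOf, h]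

/-- The cubic character of `x + y √-3` over its conjugate, modulo a prime `r ∣ 2 * x`. -/
lemma map_pow_eq_map_star_pow {r : ℕ} (hr : r.Prime) (hr3 : r ≠ 3) {x y : ℤ}
    (hrx : (r : ℤ) ∣ 2 * x) {F : Type*} [Field F] [CharP F r]
    (φ : EisensteinInt →+* F) :
    φ ⟨x + y, 2 * y⟩ ^ ((r ^ 2 - 1) / 3) = φ (star ⟨x + y, 2 * y⟩) ^ ((r ^ 2 - 1) / 3) := by
  have hα : (⟨x + y, 2 * y⟩ : EisensteinInt) =
      (x : EisensteinInt) + (y : EisensteinInt) * (1 + 2 * ω) := by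
    ext <;> simp [mul_comm]
  have hα' : (star ⟨x + y, 2 * y⟩ : EisensteinInt) =
      (x : EisensteinInt) - (y : EisensteinInt) * (1 + 2 * ω) := by
    ext
    · simp; ring
    · simp [mul_comm]
  rw [hα', hα]
  simp only [map_add, map_sub, map_mul, map_intCast, map_one]
  by_cases h2 : r = 2
  · subst h2
    have h0 : ((2 : ℕ) : F) = 0 := CharP.cast_eq_zero F 2
    have : φ (2 : EisensteinInt) = 0 := by rw [map_ofNat]; exact_mod_cast h0
    congr 1
    rw [this]
    push_cast at h0
    linear_combination (y : F) * h0
  · have hr2 : ¬ (r : ℤ) ∣ 2 := by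
      intro h
      have : r ∣ 2 := by exact_mod_cast h
      exact h2 ((Nat.prime_dvd_prime_iff_eq hr Nat.prime_two).mp this)
    have hx : (x : F) = 0 := by
      rw [CharP.intCast_eq_zero_iff F r]
      exact ((Nat.prime_iff_prime_int.mp hr).dvd_or_dvd hrx).resolve_left hr2
    rw [hx, zero_add, zero_sub, (even_sq_sub_one_div_three hr h2 hr3).neg_pow]

theorem map_pow_eq_of_dvd {x y : ℤ} {i : ℕ} {α : EisensteinInt}
    (hα : α = ω ^ i * ⟨x + y, 2 * y⟩) (him : 3 ∣ α.im) (hre : ¬ 3 ∣ α.re)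
    (hx3 : ¬ 3 ∣ x) (hx0 : x ≠ 0) (hcop : IsCoprime (2 * x) α.norm)
    {p : ℕ} (hp : p.Prime) (hp3 : p ≠ 3) (hpN : IsCoprime (p : ℤ) α.norm)
    (hdvd : α.norm ∣ p - (2 * x) ^ 2 ∨ α.norm ∣ p - -(2 * x) ^ 2)
    {F : Type} [Field F] [CharP F p] (φ : EisensteinInt →+* F) :
    φ ⟨x + y, 2 * y⟩ ^ ((p ^ 2 - 1) / 3) =
      φ ω ^ (i * (((2 * x.natAbs) ^ 2 - 1) / 3 + (p ^ 2 - 1) / 3)) *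
        φ (star ⟨x + y, 2 * y⟩) ^ ((p ^ 2 - 1) / 3) := by
  obtain ⟨χ, h1, h2, h3⟩ := hasCubicSymbol_of_primary α him hre
  set A : EisensteinInt := ⟨x + y, 2 * y⟩ with hA
  have hstar : star α = ω ^ (2 * i) * star A := by
    rw [hα, star_mul, star_pow, star_omega, ← pow_mul, mul_comm]
  have hdvd2 (n : ℕ) : (n : ℤ) ∣ 2 * x ↔ n ∣ 2 * x.natAbs := by
    rw [Int.natCast_dvd, Int.natAbs_mul]; rfl
  have hprime (r : ℕ) (hr : r.Prime) (hrx : r ∣ 2 * x.natAbs) :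
      r ≠ 3 ∧ χ r = ω ^ (2 * i * ((r ^ 2 - 1) / 3)) := by
    have hr3 : r ≠ 3 := by rintro rfl; omega
    refine ⟨hr3, ?_⟩
    have : Fact r.Prime := ⟨hr⟩
    let K := AlgebraicClosure (ZMod r)
    have hK3 : (3 : K) ≠ 0 := by
      have : ((3 : ℕ) : K) ≠ 0 := by
        rw [Ne, CharP.cast_eq_zero_iff K r, Nat.prime_dvd_prime_iff_eq hr Nat.prime_three]
        exact hr3
      exact_mod_cast this
    obtain ⟨w, hw⟩ : ∃ w : K, w ^ 2 + w + 1 = 0 := exists_sq_add_self_add_one K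
    let Φ := toRing w hw
    have hrc : IsCoprime (r : ℤ) α.norm := hcop.of_isCoprime_of_dvd_left ((hdvd2 r).mpr hrx)
    have e1 := h3 r hr hr3 hrc K Φ
    have e2 := map_pow_eq_map_star_pow (y := y) hr hr3 ((hdvd2 r).mpr hrx) Φ
    rw [hstar, hα, map_mul, map_mul, mul_pow, mul_pow, hA, e2, ← hA, ← mul_assoc] at e1
    have hne : Φ (star A) ^ ((r ^ 2 - 1) / 3) ≠ 0 := by
      apply pow_ne_zero
      intro h0
      have hN : ((α.norm : ℤ) : K) = 0 := by
        rw [← map_intCast Φ, ← mul_star_self, map_mul, hstar, map_mul Φ _ (star A), h0]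
        simp
      rw [CharP.intCast_eq_zero_iff K r] at hN
      have := hrc.isUnit_of_dvd' dvd_rfl hN
      exact (Nat.prime_iff_prime_int.mp hr).not_isUnit this
    replace e1 := mul_right_cancel₀ hne e1
    have hχ3 := h1 r hrc
    have hu : (χ r * ω ^ (i * ((r ^ 2 - 1) / 3))) = 1 := by
      refine eq_one_of_map_eq_one hK3 Φ ?_ ?_
      · rw [mul_pow, hχ3, ← pow_mul, mul_comm, mul_one, mul_comm _ 3, pow_mul, omega_pow_three,
          one_pow]
      · have hw0 : Φ ω ≠ 0 := by
          intro h
          have := congrArg Φ omega_pow_three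
          rw [map_pow, h, map_one] at this
          simp at this
        apply mul_right_cancel₀ (pow_ne_zero (i * ((r ^ 2 - 1) / 3)) hw0)
        rw [map_mul, map_pow, one_mul]
        rw [map_pow, map_pow, ← pow_mul, ← pow_mul] at e1
        linear_combination -e1
    calc χ r = χ r * ω ^ (i * ((r ^ 2 - 1) / 3)) * ω ^ (2 * i * ((r ^ 2 - 1) / 3)) := by
          rw [mul_assoc, ← pow_add, omega_pow_eq (b := 0), pow_zero, mul_one]
          rw [show i * ((r ^ 2 - 1) / 3) + 2 * i * ((r ^ 2 - 1) / 3) =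
            3 * (i * ((r ^ 2 - 1) / 3)) by ring]
          simp
      _ = _ := by rw [hu, one_mul]
  have hall (n : ℕ) : n ∣ 2 * x.natAbs →
      n ^ 2 = 3 * ((n ^ 2 - 1) / 3) + 1 ∧ χ n = ω ^ (2 * i * ((n ^ 2 - 1) / 3)) := by
    induction n using induction_on_primes with
    | zero =>
      intro h
      rw [zero_dvd_iff] at h
      omega
    | one => simp
    | prime_mul r k hr ih =>
      intro h
      obtain ⟨k1, k2⟩ := ih (dvd_of_mul_left_dvd h)
      obtain ⟨hr3, r2⟩ := hprime r hr (dvd_of_mul_right_dvd h)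
      have r1 := sq_eq_three_mul_add_one_of_prime hr hr3
      set a := (r ^ 2 - 1) / 3
      set b := (k ^ 2 - 1) / 3
      have hab : (r * k) ^ 2 = 3 * (3 * a * b + a + b) + 1 := by rw [mul_pow, r1, k1]; ring
      have hab' : ((r * k) ^ 2 - 1) / 3 = 3 * a * b + a + b := by omega
      refine ⟨by omega, ?_⟩
      rw [hab', Nat.cast_mul, map_mul, k2, r2, ← pow_add]
      apply omega_pow_eq
      rw [show 2 * i * (3 * a * b + a + b) = 2 * i * a + 2 * i * b + 3 * (2 * i * a * b) by ring]
      simp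
  obtain ⟨M1, M2⟩ := hall _ dvd_rfl
  set M := ((2 * x.natAbs) ^ 2 - 1) / 3
  set m := (p ^ 2 - 1) / 3
  have hneg : χ (-1) = 1 := by
    have u1 := h1 (-1) isCoprime_one_left.neg_left
    have u2 : χ (-1) ^ 2 = 1 := by rw [← map_pow]; simp
    linear_combination u1 - χ (-1) * u2
  have hx2 : (2 * x) ^ 2 = ((2 * x.natAbs : ℕ) : ℤ) ^ 2 := by
    push_cast
    rw [mul_pow, mul_pow, sq_abs]
  have hχp : χ p = ω ^ (i * M) := by
    have : χ p = χ ((2 * x) ^ 2) := by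
      rcases hdvd with h | h
      · exact h2 _ _ h
      · rw [h2 _ _ h, show -(2 * x) ^ 2 = (-1) * (2 * x) ^ 2 by ring, map_mul, hneg, one_mul]
    rw [this, hx2, map_pow, M2, ← pow_mul]
    apply omega_pow_eq
    rw [show 2 * i * M * 2 = i * M + 3 * (i * M) by ring]
    simp
  have e := h3 p hp hp3 hpN F φ
  rw [hχp, hstar, hα, map_mul, map_mul, mul_pow, mul_pow] at e
  simp only [map_pow, ← pow_mul] at e
  have hw3 : φ ω ^ 3 = 1 := by rw [← map_pow, omega_pow_three, map_one]
  have hw3' : φ ω ^ (i * m) * φ ω ^ (2 * i * m) = 1 := by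
    rw [← pow_add, show i * m + 2 * i * m = 3 * (i * m) by ring, pow_mul, hw3, one_pow]
  rw [mul_add, pow_add]
  linear_combination φ ω ^ (2 * i * m) * e +
    (φ ω ^ (i * M) * φ ω ^ (i * m) * φ (star A) ^ m - φ A ^ m) * hw3'

/-- Cubic reciprocity for `x + y √-3` and a prime congruent to `± 4 x ^ 2` modulo its norm. -/
theorem add_pow_eq_sub_pow_of_dvd {x y : ℤ} {p : ℕ} (hp : p.Prime) (hp3 : p ≠ 3)
    (hx3 : ¬ 3 ∣ x) (hcop : IsCoprime (2 * x) (x ^ 2 + 3 * y ^ 2))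
    (hpN : IsCoprime (p : ℤ) (x ^ 2 + 3 * y ^ 2))
    (hdvd : x ^ 2 + 3 * y ^ 2 ∣ p - (2 * x) ^ 2 ∨ x ^ 2 + 3 * y ^ 2 ∣ p - -(2 * x) ^ 2)
    {F : Type} [Field F] [CharP F p] {w : F} (hw : w ^ 2 + w + 1 = 0) :
    (3 ∣ y → (x + y * (1 + 2 * w)) ^ ((p ^ 2 - 1) / 3) =
      (x - y * (1 + 2 * w)) ^ ((p ^ 2 - 1) / 3)) ∧
    (3 ∣ y - x → ∀ k : ℕ, 3 * (k : ℤ) + 2 = p ^ 2 + (2 * x) ^ 2 →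
      (x + y * (1 + 2 * w)) ^ ((p ^ 2 - 1) / 3) =
        w ^ k * (x - y * (1 + 2 * w)) ^ ((p ^ 2 - 1) / 3)) := by
  have hx0 : x ≠ 0 := by rintro rfl; simp at hx3
  let φ := toRing w hw
  have hω : φ ω = w := by simp [φ, toRing]
  have e1 : φ ⟨x + y, 2 * y⟩ = x + y * (1 + 2 * w) := by simp [φ, toRing]; ring
  have e2 : φ (star ⟨x + y, 2 * y⟩) = x - y * (1 + 2 * w) := by simp [φ, toRing]; ring
  have key (i : ℕ) (α : EisensteinInt) (hα : α = ω ^ i * ⟨x + y, 2 * y⟩) (him : 3 ∣ α.im)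
      (hre : ¬ 3 ∣ α.re) (hN : α.norm = x ^ 2 + 3 * y ^ 2) :
      (x + y * (1 + 2 * w)) ^ ((p ^ 2 - 1) / 3) =
        w ^ (i * (((2 * x.natAbs) ^ 2 - 1) / 3 + (p ^ 2 - 1) / 3)) *
          (x - y * (1 + 2 * w)) ^ ((p ^ 2 - 1) / 3) := by
    rw [← hN] at hcop hpN hdvd
    have := map_pow_eq_of_dvd hα him hre hx3 hx0 hcop hp hp3 hpN hdvd φ
    rwa [hω, e1, e2] at this
  refine ⟨fun hy => ?_, fun hy k hk => ?_⟩
  · have := key 0 ⟨x + y, 2 * y⟩ (by simp) (by simp only; omega) (by simp only; omega)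
      (by rw [norm_eq]; ring)
    simpa using this
  · have hωA : (ω : EisensteinInt) ^ 1 * ⟨x + y, 2 * y⟩ = ⟨-(2 * y), x - y⟩ := by
      ext <;> simp
      ring
    have := key 1 ⟨-(2 * y), x - y⟩ hωA.symm (by simp only; omega) (by simp only; omega)
      (by rw [norm_eq]; ring)
    rw [this]
    congr 2
    have h1 := sq_eq_three_mul_add_one_of_prime hp hp3
    have h2 : ((2 * x.natAbs : ℕ) : ℤ) ^ 2 = (2 * x) ^ 2 := by
      push_cast
      rw [mul_pow, mul_pow, sq_abs]
    have h3 : (x.natAbs * x.natAbs) % 3 = 1 := by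
      have : x.natAbs % 3 = 1 ∨ x.natAbs % 3 = 2 := by omega
      rcases this with h | h <;> rw [Nat.mul_mod, h]
    have h4 : (2 * x.natAbs) ^ 2 = 4 * (x.natAbs * x.natAbs) := by ring
    rw [← h2] at hk
    have hk' : 3 * k + 2 = p ^ 2 + (2 * x.natAbs) ^ 2 := by exact_mod_cast hk
    omega

end EisensteinInt

section Field

variable {K : Type*} [Field K] {p : ℕ} [CharP K p] {s c : K}

lemma half_add_pow_char (hp : p.Prime) (s : K) :
    ((1 + s) / 2) ^ p = (1 + s ^ p) / 2 := by
  have : Fact p.Prime := ⟨hp⟩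
  rw [div_pow, add_pow_char, one_pow]
  congr 1
  have := map_ofNat (frobenius K p) 2
  rwa [frobenius_def] at this

/-- The sum at a cube root of unity `c` recording the cubic character of `(1 + s) / 2`, when
`p ≡ 1 (mod 3)`. -/
lemma sum_mul_eq_of_mod_three_eq_one (hp : p.Prime) (hp2 : p ≠ 2) (hp3 : p % 3 = 1)
    (hs : s ^ 2 = 5) (hsp : s ^ p = s) (hc : c ^ 3 = 1)
    (h : ((1 + s) / 2) ^ ((p ^ 2 - 1) / 3) = c * ((1 - s) / 2) ^ ((p ^ 2 - 1) / 3)) :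
    (∑ k ∈ Finset.range (p / 3 + 1), ((3 * k).choose k : K) / 3 ^ k) * s * 2 =
      c * (3 + s) - c ^ 2 * (3 - s) := by
  have h20 : (2 : K) ≠ 0 := Ring.two_ne_zero (by rwa [ringChar.eq K p])
  rw [sum_choose_three_mul hp hp2 (by rintro rfl; omega) hs]
  have hεp := half_add_pow_char hp s
  rw [hsp] at hεp
  have hεε : (1 + s) / 2 * ((1 - s) / 2) = -1 := by
    field_simp
    linear_combination -hs
  have hεs : ((1 + s) / 2) ^ 2 * 2 = 3 + s := by
    field_simp
    linear_combination hs
  have hεs' : ((1 - s) / 2) ^ 2 * 2 = 3 - s := by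
    field_simp
    linear_combination hs
  set ε := (1 + s) / 2
  set ε' := (1 - s) / 2
  have hε0 : ε ≠ 0 := by
    intro h
    simp [h] at hεε
  set n := p / 3
  obtain ⟨a, ha⟩ : Even n := by
    have := hp.odd_of_ne_two hp2
    obtain ⟨b, hb⟩ := this
    rw [Nat.even_iff]
    omega
  have hpn : p = 3 * n + 1 := by omega
  have hm : (p ^ 2 - 1) / 3 = n * (3 * n + 2) := by
    rw [hpn, show (3 * n + 1) ^ 2 = 3 * (n * (3 * n + 2)) + 1 by ring]
    omega
  rw [hm] at h
  have hε3 : ε ^ (3 * n) = 1 := by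
    apply mul_right_cancel₀ hε0
    rw [← pow_succ, ← hpn, hεp, one_mul]
  have h4 : ε ^ (4 * n) = c := by
    have e1 : ε ^ (n * (3 * n + 2)) * ε ^ (n * (3 * n + 2)) = c := by
      nth_rewrite 1 [h]
      rw [mul_assoc, ← mul_pow, mul_comm ε', hεε, Even.neg_one_pow, mul_one]
      exact (Even.mul_right ⟨a, ha⟩ _)
    rw [← pow_add, show n * (3 * n + 2) + n * (3 * n + 2) = 3 * n * (2 * n) + 4 * n by ring,
      pow_add, pow_mul, hε3, one_pow, one_mul] at e1
    exact e1
  have h5 : ε' ^ (4 * n) = c ^ 2 := by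
    have hc0 : c ≠ 0 := by rintro rfl; simp at hc
    apply mul_left_cancel₀ hc0
    nth_rewrite 1 [← h4]
    rw [← mul_pow, hεε, ← pow_succ', hc, Even.neg_one_pow]
    exact ⟨2 * n, by ring⟩
  rw [Even.neg_one_pow ⟨a, ha⟩, pow_add, pow_add, h4, h5, one_mul, ← hεs, ← hεs']
  ring

/-- The sum at a cube root of unity `c` recording the cubic character of `(1 + s) / 2`, when
`p ≡ 2 (mod 3)`. -/
lemma sum_mul_eq_of_mod_three_eq_two (hp : p.Prime) (hp2 : p ≠ 2) (hp3 : p % 3 = 2)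
    (hs : s ^ 2 = 5) (hsp : s ^ p = -s) (hc : c ^ 3 = 1)
    (h : ((1 + s) / 2) ^ ((p ^ 2 - 1) / 3) = c * ((1 - s) / 2) ^ ((p ^ 2 - 1) / 3)) :
    (∑ k ∈ Finset.range (p / 3 + 1), ((3 * k).choose k : K) / 3 ^ k) * s * 2 =
      c * (3 + s) - c ^ 2 * (3 - s) := by
  have h20 : (2 : K) ≠ 0 := Ring.two_ne_zero (by rwa [ringChar.eq K p])
  rw [sum_choose_three_mul hp hp2 (by rintro rfl; omega) hs]
  have hεp := half_add_pow_char hp s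
  rw [hsp, ← sub_eq_add_neg] at hεp
  have hεε : (1 + s) / 2 * ((1 - s) / 2) = -1 := by
    field_simp
    linear_combination -hs
  have hεs : ((1 + s) / 2) ^ 2 * 2 = 3 + s := by
    field_simp
    linear_combination hs
  have hεs' : ((1 - s) / 2) ^ 2 * 2 = 3 - s := by
    field_simp
    linear_combination hs
  set ε := (1 + s) / 2
  set ε' := (1 - s) / 2
  set n := p / 3
  obtain ⟨a, ha⟩ : Odd n := by
    have := hp.odd_of_ne_two hp2
    obtain ⟨b, hb⟩ := this
    rw [Nat.odd_iff]
    omega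
  have hpn : p = 3 * n + 2 := by omega
  have hm : (p ^ 2 - 1) / 3 = (n + 1) * (3 * n + 1) := by
    rw [hpn, show (3 * n + 2) ^ 2 = 3 * ((n + 1) * (3 * n + 1)) + 1 by ring]
    omega
  rw [hm] at h
  have hε3 : ε ^ (3 * (n + 1)) = -1 := by
    rw [show 3 * (n + 1) = p + 1 by omega, pow_succ', hεp, hεε]
  have h2 : ε ^ (2 * (n + 1)) = c := by
    have e1 : ε ^ ((n + 1) * (3 * n + 1)) * ε ^ ((n + 1) * (3 * n + 1)) = c := by
      nth_rewrite 1 [h]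
      rw [mul_assoc, ← mul_pow, mul_comm ε', hεε, Even.neg_one_pow, mul_one]
      exact Even.mul_right ⟨a + 1, by omega⟩ _
    rw [← pow_add, show (n + 1) * (3 * n + 1) + (n + 1) * (3 * n + 1) =
        3 * (n + 1) * (2 * n) + 2 * (n + 1) by ring, pow_add, pow_mul, hε3,
      Even.neg_one_pow (even_two_mul n), one_mul] at e1
    exact e1
  have h4 : ε ^ (4 * n + 2) = c ^ 2 * ε' ^ 2 := by
    have e : ε ^ 2 * ε' ^ 2 = 1 := by
      rw [← mul_pow, hεε]
      simp
    rw [← h2]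
    linear_combination -ε ^ (4 * n + 2) * e
  have h5 : ε' ^ (4 * n + 2) = c * ε ^ 2 := by
    have e : ε ^ (4 * n + 2) * ε' ^ (4 * n + 2) = 1 := by
      rw [← mul_pow, hεε, Even.neg_one_pow]
      exact ⟨2 * n + 1, by ring⟩
    rw [h4] at e
    have e' : ε ^ 2 * ε' ^ 2 = 1 := by
      rw [← mul_pow, hεε]
      simp
    linear_combination c * ε ^ 2 * e - ε' ^ (4 * n + 2) * (e' + ε ^ 2 * ε' ^ 2 * hc)
  rw [Odd.neg_one_pow ⟨a, ha⟩, h4, h5, ← hεs, ← hεs']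
  ring

end Field

lemma one_add_two_mul_pow_char {K : Type*} [Field K] {p : ℕ} [CharP K p] (hp : p.Prime) (w : K) :
    (1 + 2 * w) ^ p = 1 + 2 * w ^ p := by
  have : Fact p.Prime := ⟨hp⟩
  have := map_ofNat (frobenius K p) 2
  rw [frobenius_def] at this
  rw [add_pow_char, one_pow, mul_pow, this]

lemma intCast_pow_char {K : Type*} [Field K] {p : ℕ} [CharP K p] (hp : p.Prime) (n : ℤ) :
    (n : K) ^ p = n := by
  have : Fact p.Prime := ⟨hp⟩
  have := map_intCast (frobenius K p) n
  rwa [frobenius_def] at this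

lemma isCoprime_of_prime_eq {p : ℕ} (hp : p.Prime) {a b x y : ℤ}
    (h : (p : ℤ) = a * x ^ 2 + b * y ^ 2) : IsCoprime x y := by
  rw [Int.isCoprime_iff_gcd_eq_one]
  by_contra hg
  obtain ⟨q, hq, hqd⟩ := Nat.exists_prime_and_dvd hg
  have hqx : (q : ℤ) ∣ x := (Int.natCast_dvd_natCast.mpr hqd).trans (Int.gcd_dvd_left ..)
  have hqy : (q : ℤ) ∣ y := (Int.natCast_dvd_natCast.mpr hqd).trans (Int.gcd_dvd_right ..)
  have : ((q ^ 2 : ℕ) : ℤ) ∣ p := by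
    rw [h]
    push_cast
    exact dvd_add ((pow_dvd_pow_of_dvd hqx 2).mul_left _) ((pow_dvd_pow_of_dvd hqy 2).mul_left _)
  have : q ^ 2 ∣ p := by exact_mod_cast this
  have hqp := (Nat.prime_dvd_prime_iff_eq hq hp).mp ((dvd_pow_self q two_ne_zero).trans this)
  subst hqp
  have h1 := Nat.le_of_dvd hq.pos this
  nlinarith [hq.two_le]

lemma isCoprime_two_mul_of_odd {x y : ℤ} (hxy : IsCoprime x y) (hx3 : ¬ 3 ∣ x)
    (hodd : Odd (x + y)) : IsCoprime (2 * x) (x ^ 2 + 3 * y ^ 2) := by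
  refine IsCoprime.mul_left ?_ ?_
  · rw [Int.isCoprime_two_left]
    have h : Odd ((x + y) ^ 2) := hodd.pow
    have : x ^ 2 + 3 * y ^ 2 = (x + y) ^ 2 + 2 * (y ^ 2 - x * y) := by ring
    rw [this]
    exact h.add_even (even_two_mul _)
  · have h3 : IsCoprime x 3 :=
      (((Int.prime_three).coprime_iff_not_dvd).mpr hx3).symm
    have : IsCoprime x (3 * y ^ 2) := h3.mul_right hxy.pow_right
    rw [add_comm, sq x]
    exact IsCoprime.add_mul_left_right this x

lemma isCoprime_of_dvd_imp_dvd_two_mul_sq {p : ℕ} (hp : p.Prime) (hp2 : p ≠ 2) {x N : ℤ}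
    (hx : ¬ (p : ℤ) ∣ x) (h : (p : ℤ) ∣ N → (p : ℤ) ∣ (2 * x) ^ 2) : IsCoprime (p : ℤ) N := by
  have hpi := Nat.prime_iff_prime_int.mp hp
  rw [hpi.coprime_iff_not_dvd]
  intro hN
  rcases hpi.dvd_or_dvd (hpi.dvd_of_dvd_pow (h hN)) with h2 | h2
  · have : p ∣ 2 := by exact_mod_cast h2
    exact hp2 ((Nat.prime_dvd_prime_iff_eq hp Nat.prime_two).mp this)
  · exact hx h2

lemma not_dvd_of_prime_eq {p : ℕ} (hp : p.Prime) {a b x y : ℤ}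
    (h : (p : ℤ) = a * x ^ 2 + b * y ^ 2) (hb : ¬ (p : ℤ) ∣ b) : ¬ (p : ℤ) ∣ x := by
  intro hx
  have hpi := Nat.prime_iff_prime_int.mp hp
  have h1 : (p : ℤ) ∣ b * y ^ 2 := by
    have : b * y ^ 2 = p - a * x * x := by linear_combination -h
    rw [this]
    exact dvd_sub dvd_rfl (hx.mul_left _)
  have hy := hpi.dvd_of_dvd_pow ((hpi.dvd_or_dvd h1).resolve_left hb)
  exact hpi.not_isUnit ((isCoprime_of_prime_eq hp h).isUnit_of_dvd' hx hy)

lemma exists_sq_eq_three_mul_add_one {x : ℤ} (hx : ¬ 3 ∣ x) : ∃ t : ℕ, x ^ 2 = 3 * t + 1 := by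
  have h : x ^ 2 % 3 = 1 := by
    have : x % 3 = 1 ∨ x % 3 = 2 := by omega
    rcases this with h | h <;> simp [pow_two, Int.mul_emod, h]
  have := sq_nonneg x
  exact ⟨(x ^ 2 / 3).toNat, by omega⟩

lemma sum_eq_of_prime_eq_sq_add_fifteen_mul_sq {K : Type} [Field K] [IsAlgClosed K] {p : ℕ}
    [CharP K p] (hp : p.Prime) (hp2 : p ≠ 2) (hp3 : p % 3 = 1) (hp5 : p ≠ 5) {x y : ℤ}
    (h : (p : ℤ) = x ^ 2 + 15 * y ^ 2) :
    (3 ∣ y → ∑ k ∈ Finset.range (p / 3 + 1), ((3 * k).choose k : K) / 3 ^ k = 1) ∧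
    (3 ∣ y - x → ∑ k ∈ Finset.range (p / 3 + 1), ((3 * k).choose k : K) / 3 ^ k =
      -(3 * x + 5 * y) / (10 * y)) := by
  have hpne (q : ℕ) (hq : q.Prime) (hpq : p ≠ q) : ¬ (p : ℤ) ∣ q := fun hd =>
    hpq ((Nat.prime_dvd_prime_iff_eq hp hq).mp (by exact_mod_cast hd))
  have hp3' : p ≠ 3 := by omega
  have hpi := Nat.prime_iff_prime_int.mp hp
  have hx : ¬ (p : ℤ) ∣ x := not_dvd_of_prime_eq hp (a := 1) (b := 15) (y := y) (by rw [h]; ring)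
    fun hd => by
      rw [show (15 : ℤ) = (3 : ℕ) * (5 : ℕ) by norm_num] at hd
      exact (hpi.dvd_or_dvd hd).elim (hpne 3 Nat.prime_three hp3') (hpne 5 Nat.prime_five hp5)
  have hy : ¬ (p : ℤ) ∣ y := not_dvd_of_prime_eq hp (a := 15) (b := 1) (y := x) (by rw [h]; ring)
    fun hd => hpi.not_isUnit (isUnit_of_dvd_one hd)
  have hxy : IsCoprime x y := isCoprime_of_prime_eq hp (a := 1) (b := 15) (by rw [h]; ring)
  have hx3 : ¬ 3 ∣ x := by
    rintro ⟨z, rfl⟩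
    have : (p : ℤ) = 3 * (3 * z ^ 2 + 5 * y ^ 2) := by rw [h]; ring
    omega
  have hodd : Odd (x + y) := by
    have h1 : Odd (p : ℤ) := by exact_mod_cast hp.odd_of_ne_two hp2
    have h2 : (x + y) ^ 2 = p + 2 * (x * y - 7 * y ^ 2) := by rw [h]; ring
    have h3 : Odd ((x + y) ^ 2) := by
      rw [h2]
      exact h1.add_even (even_two_mul _)
    exact (Int.odd_pow' two_ne_zero).mp h3
  have hcop := isCoprime_two_mul_of_odd hxy hx3 hodd
  have hpN : IsCoprime (p : ℤ) (x ^ 2 + 3 * y ^ 2) :=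
    isCoprime_of_dvd_imp_dvd_two_mul_sq hp hp2 hx fun hd => by
      rw [show (2 * x) ^ 2 = 5 * (x ^ 2 + 3 * y ^ 2) - p by rw [h]; ring]
      exact dvd_sub (hd.mul_left _) dvd_rfl
  obtain ⟨w, hw⟩ := EisensteinInt.exists_sq_add_self_add_one K
  obtain ⟨k1, k2⟩ := EisensteinInt.add_pow_eq_sub_pow_of_dvd hp hp3' hx3 hcop hpN
    (.inr ⟨5, by rw [h]; ring⟩) hw
  have hne (n : ℤ) (hn : ¬ (p : ℤ) ∣ n) : (n : K) ≠ 0 := by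
    rwa [Ne, CharP.intCast_eq_zero_iff K p]
  have hX := hne x hx
  have hY := hne y hy
  have h2 : (2 : K) ≠ 0 := by exact_mod_cast hne _ (hpne 2 Nat.prime_two hp2)
  have h3 : (3 : K) ≠ 0 := by exact_mod_cast hne _ (hpne 3 Nat.prime_three hp3')
  have h5 : (5 : K) ≠ 0 := by exact_mod_cast hne _ (hpne 5 Nat.prime_five hp5)
  have h10 : (10 : K) ≠ 0 := by
    rw [show (10 : K) = 2 * 5 by norm_num]
    exact mul_ne_zero h2 h5
  have hXY : (x : K) ^ 2 + 15 * (y : K) ^ 2 = 0 := by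
    rw [← CharP.cast_eq_zero K p]
    exact_mod_cast (congrArg (Int.cast : ℤ → K) h).symm
  have hw3 : w ^ 3 = 1 := by linear_combination (w - 1) * hw
  have hθ : (1 + 2 * w) ^ 2 = -3 := by linear_combination 4 * hw
  have hθ0 : 1 + 2 * w ≠ 0 := fun h0 => h3 (by linear_combination hθ - (1 + 2 * w) * h0)
  have hwp : w ^ p = w := by
    rw [← Nat.div_add_mod p 3, hp3, pow_succ, pow_mul, hw3, one_pow, one_mul]
  have hθp := one_add_two_mul_pow_char hp w
  rw [hwp] at hθp
  generalize hθdef : 1 + 2 * w = θ at *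
  obtain ⟨s, hsdef⟩ : ∃ s : K, s = x / (y * θ) := ⟨_, rfl⟩
  have hs : s ^ 2 = 5 := by
    rw [hsdef]
    field_simp
    linear_combination hXY - 5 * (y : K) ^ 2 * hθ
  have hsp : s ^ p = s := by
    rw [hsdef, div_pow, mul_pow, intCast_pow_char hp, intCast_pow_char hp, hθp]
  have hs0 : s ≠ 0 := hsdef ▸ div_ne_zero hX (mul_ne_zero hY hθ0)
  have key (c : K) (hc : c ^ 3 = 1)
      (hc' : (x + y * θ) ^ ((p ^ 2 - 1) / 3) = c * (x - y * θ) ^ ((p ^ 2 - 1) / 3)) :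
      (∑ k ∈ Finset.range (p / 3 + 1), ((3 * k).choose k : K) / 3 ^ k) * s * 2 =
        c * (3 + s) - c ^ 2 * (3 - s) := by
    refine sum_mul_eq_of_mod_three_eq_one hp hp2 hp3 hs hsp hc ?_
    have e1 : (1 + s) / 2 = (x + y * θ) / (2 * y * θ) := by
      rw [hsdef]
      field_simp
      ring
    have e2 : (1 - s) / 2 = -((x - y * θ) / (2 * y * θ)) := by
      rw [hsdef]
      field_simp
      ring
    rw [e1, e2, (even_sq_sub_one_div_three hp hp2 hp3').neg_pow, div_pow, div_pow,
      hc', mul_div_assoc]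
  refine ⟨fun h3y => ?_, fun h3yx => ?_⟩
  · apply mul_right_cancel₀ (mul_ne_zero hs0 h2)
    linear_combination key 1 (one_pow 3) (by rw [one_mul]; exact k1 h3y)
  · obtain ⟨t, ht⟩ := exists_sq_eq_three_mul_add_one hx3
    obtain ⟨v, hv⟩ := exists_sq_eq_three_mul_add_one (x := y) (by omega)
    have hk := k2 h3yx (3 * ((t + 15 * v) ^ 2 + 12 * t + 160 * v + 28) + 2) (by
      push_cast
      rw [h, mul_pow, ht, hv]
      ring)
    rw [pow_add w, pow_mul w, hw3, one_pow, one_mul] at hk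
    have hS := key (w ^ 2) (by rw [← pow_mul, mul_comm, pow_mul, hw3, one_pow]) hk
    have hxs : x * s = 5 * y * θ := by
      rw [hsdef]
      field_simp
      linear_combination hXY - 5 * (y : K) ^ 2 * hθ
    rw [eq_div_iff (mul_ne_zero h10 hY)]
    apply mul_right_cancel₀ hs0
    linear_combination 5 * y * hS - 5 * y * w * (3 - s) * hw3 + 5 * y * (3 + s) * hw -
      15 * y * hθdef + 3 * hxs

lemma sum_eq_of_prime_eq_five_mul_sq_add_three_mul_sq {K : Type} [Field K] [IsAlgClosed K] {p : ℕ}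
    [CharP K p] (hp : p.Prime) (hp2 : p ≠ 2) (hp3 : p % 3 = 2) (hp5 : p ≠ 5) {x y : ℤ}
    (h : (p : ℤ) = 5 * x ^ 2 + 3 * y ^ 2) :
    (3 ∣ y → ∑ k ∈ Finset.range (p / 3 + 1), ((3 * k).choose k : K) / 3 ^ k = 1) ∧
    (3 ∣ y - x → ∑ k ∈ Finset.range (p / 3 + 1), ((3 * k).choose k : K) / 3 ^ k =
      (3 * x - y) / (2 * y)) := by
  have hpne (q : ℕ) (hq : q.Prime) (hpq : p ≠ q) : ¬ (p : ℤ) ∣ q := fun hd =>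
    hpq ((Nat.prime_dvd_prime_iff_eq hp hq).mp (by exact_mod_cast hd))
  have hp3' : p ≠ 3 := by omega
  have hx : ¬ (p : ℤ) ∣ x := not_dvd_of_prime_eq hp h (hpne 3 Nat.prime_three hp3')
  have hy : ¬ (p : ℤ) ∣ y := not_dvd_of_prime_eq hp (a := 3) (b := 5) (y := x) (by rw [h]; ring)
    (hpne 5 Nat.prime_five hp5)
  have hx3 : ¬ 3 ∣ x := by
    rintro ⟨z, rfl⟩
    have : (p : ℤ) = 3 * (15 * z ^ 2 + y ^ 2) := by rw [h]; ring
    omega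
  have hodd : Odd (x + y) := by
    have h1 : Odd (p : ℤ) := by exact_mod_cast hp.odd_of_ne_two hp2
    have h2 : (x + y) ^ 2 = p + 2 * (x * y - 2 * x ^ 2 - y ^ 2) := by rw [h]; ring
    have h3 : Odd ((x + y) ^ 2) := by
      rw [h2]
      exact h1.add_even (even_two_mul _)
    exact (Int.odd_pow' two_ne_zero).mp h3
  have hcop := isCoprime_two_mul_of_odd (isCoprime_of_prime_eq hp h) hx3 hodd
  have hpN : IsCoprime (p : ℤ) (x ^ 2 + 3 * y ^ 2) :=
    isCoprime_of_dvd_imp_dvd_two_mul_sq hp hp2 hx fun hd => by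
      rw [show (2 * x) ^ 2 = p - (x ^ 2 + 3 * y ^ 2) by rw [h]; ring]
      exact dvd_sub dvd_rfl hd
  obtain ⟨w, hw⟩ := EisensteinInt.exists_sq_add_self_add_one K
  obtain ⟨k1, k2⟩ := EisensteinInt.add_pow_eq_sub_pow_of_dvd hp hp3' hx3 hcop hpN
    (.inl ⟨1, by rw [h]; ring⟩) hw
  have hne (n : ℤ) (hn : ¬ (p : ℤ) ∣ n) : (n : K) ≠ 0 := by
    rwa [Ne, CharP.intCast_eq_zero_iff K p]
  have hX := hne x hx
  have hY := hne y hy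
  have h2 : (2 : K) ≠ 0 := by exact_mod_cast hne _ (hpne 2 Nat.prime_two hp2)
  have h3 : (3 : K) ≠ 0 := by exact_mod_cast hne _ (hpne 3 Nat.prime_three hp3')
  have hXY : 5 * (x : K) ^ 2 + 3 * (y : K) ^ 2 = 0 := by
    rw [← CharP.cast_eq_zero K p]
    exact_mod_cast (congrArg (Int.cast : ℤ → K) h).symm
  have hw3 : w ^ 3 = 1 := by linear_combination (w - 1) * hw
  have hθ : (1 + 2 * w) ^ 2 = -3 := by linear_combination 4 * hw
  have hθ0 : 1 + 2 * w ≠ 0 := fun h0 => h3 (by linear_combination hθ - (1 + 2 * w) * h0)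
  have hθp : (1 + 2 * w) ^ p = -(1 + 2 * w) := by
    rw [one_add_two_mul_pow_char hp w, ← Nat.div_add_mod p 3, hp3, pow_add, pow_mul, hw3, one_pow]
    linear_combination 2 * hw
  generalize hθdef : 1 + 2 * w = θ at *
  obtain ⟨s, hsdef⟩ : ∃ s : K, s = y * θ / x := ⟨_, rfl⟩
  have hs : s ^ 2 = 5 := by
    rw [hsdef]
    field_simp
    linear_combination (y : K) ^ 2 * hθ - hXY
  have hsp : s ^ p = -s := by
    rw [hsdef, div_pow, mul_pow, intCast_pow_char hp, intCast_pow_char hp, hθp]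
    ring
  have hs0 : s ≠ 0 := hsdef ▸ div_ne_zero (mul_ne_zero hY hθ0) hX
  have key (c : K) (hc : c ^ 3 = 1)
      (hc' : (x + y * θ) ^ ((p ^ 2 - 1) / 3) = c * (x - y * θ) ^ ((p ^ 2 - 1) / 3)) :
      (∑ k ∈ Finset.range (p / 3 + 1), ((3 * k).choose k : K) / 3 ^ k) * s * 2 =
        c * (3 + s) - c ^ 2 * (3 - s) := by
    refine sum_mul_eq_of_mod_three_eq_two hp hp2 hp3 hs hsp hc ?_
    have e1 : (1 + s) / 2 = (x + y * θ) / (2 * x) := by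
      rw [hsdef]
      field_simp
    have e2 : (1 - s) / 2 = (x - y * θ) / (2 * x) := by
      rw [hsdef]
      field_simp
    rw [e1, e2, div_pow, div_pow, hc', mul_div_assoc]
  refine ⟨fun h3y => ?_, fun h3yx => ?_⟩
  · apply mul_right_cancel₀ (mul_ne_zero hs0 h2)
    linear_combination key 1 (one_pow 3) (by rw [one_mul]; exact k1 h3y)
  · obtain ⟨t, ht⟩ := exists_sq_eq_three_mul_add_one hx3
    obtain ⟨v, hv⟩ := exists_sq_eq_three_mul_add_one (x := y) (by omega)
    have hk := k2 h3yx (3 * ((5 * t + 3 * v) ^ 2 + 28 * t + 16 * v + 7) + 1) (by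
      push_cast
      rw [h, mul_pow, ht, hv]
      ring)
    rw [pow_add w, pow_mul w, hw3, one_pow, one_mul, pow_one] at hk
    have hS := key w hw3 hk
    have hxs : x * s = y * θ := by
      rw [hsdef]
      field_simp
    rw [eq_div_iff (mul_ne_zero h2 hY)]
    apply mul_right_cancel₀ hs0
    linear_combination y * hS - y * (3 - s) * hw + 3 * y * hθdef - 3 * hxs

lemma algebraMap_sum_choose_div_pow {F K : Type*} [Field F] [Field K] [Algebra F K] (n : ℕ) :
    algebraMap F K (∑ k ∈ Finset.range n, ((3 * k).choose k : F) / 3 ^ k) =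
      ∑ k ∈ Finset.range n, ((3 * k).choose k : K) / 3 ^ k := by
  simp [map_sum, map_ofNat (algebraMap F K) 3]

theorem stmt15 (p : ℕ) [Fact p.Prime] (hp2 : p ≠ 2)
    (hp : p % 15 = 1 ∨ p % 15 = 2 ∨ p % 15 = 4 ∨ p % 15 = 8) :
    ((p % 15 = 1 ∨ p % 15 = 4) → ∀ x y : ℤ, (p : ℤ) = x ^ 2 + 15 * y ^ 2 →
      (((3 : ℤ) ∣ y →
        (∑ k ∈ Finset.range (p / 3 + 1),
            (Nat.choose (3 * k) k : ZMod p) / 3 ^ k) = 1) ∧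
      ((3 : ℤ) ∣ y - x →
        (∑ k ∈ Finset.range (p / 3 + 1),
            (Nat.choose (3 * k) k : ZMod p) / 3 ^ k)
          = -(3 * (x : ZMod p) + 5 * (y : ZMod p)) / (10 * (y : ZMod p))))) ∧
    ((p % 15 = 2 ∨ p % 15 = 8) → ∀ x y : ℤ, (p : ℤ) = 5 * x ^ 2 + 3 * y ^ 2 →
      (((3 : ℤ) ∣ y →
        (∑ k ∈ Finset.range (p / 3 + 1),
            (Nat.choose (3 * k) k : ZMod p) / 3 ^ k) = 1) ∧
      ((3 : ℤ) ∣ y - x →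
        (∑ k ∈ Finset.range (p / 3 + 1),
            (Nat.choose (3 * k) k : ZMod p) / 3 ^ k)
          = (3 * (x : ZMod p) - (y : ZMod p)) / (2 * (y : ZMod p))))) := by
  have hpp := Fact.out (p := p.Prime)
  let K := AlgebraicClosure (ZMod p)
  have hinj := (algebraMap (ZMod p) K).injective
  have hp5 : p ≠ 5 := by omega
  refine ⟨fun hp' x y h => ?_, fun hp' x y h => ?_⟩
  · obtain ⟨h1, h2⟩ := sum_eq_of_prime_eq_sq_add_fifteen_mul_sq (K := K) hpp hp2 (by omega) hp5 h
    refine ⟨fun hy => hinj ?_, fun hy => hinj ?_⟩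
    · rw [algebraMap_sum_choose_div_pow, h1 hy, map_one]
    · rw [algebraMap_sum_choose_div_pow, h2 hy]
      simp [map_ofNat (algebraMap (ZMod p) K)]
  · obtain ⟨h1, h2⟩ :=
      sum_eq_of_prime_eq_five_mul_sq_add_three_mul_sq (K := K) hpp hp2 (by omega) hp5 h
    refine ⟨fun hy => hinj ?_, fun hy => hinj ?_⟩
    · rw [algebraMap_sum_choose_div_pow, h1 hy, map_one]
    · rw [algebraMap_sum_choose_div_pow, h2 hy]
      simp [map_ofNat (algebraMap (ZMod p) K)]
end

section
/- Let p be a prime with p ≡ 13 (mod 24). Then, with congruences interpreted in ℤ/pℤ: (i) ∑_{k=0}^{(p−13)/24} C(24k,12k)/4^{12k} ≡ (1/12)·(1 − 2·3^{(p−1)/4}) (mod p); and (ii) ∑_{k=0}^{(p−1)/12} C(12k,6k)·(−1)^k/4^{6k} ≡ 0 (mod p). -/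
theorem centralBinom_eq_neg_four_pow_mul_choose (p n : ℕ) [Fact p.Prime] (hn : p = 2 * n + 1)
    (j : ℕ) (hj : j ≤ n) :
    (Nat.choose (2 * j) j : ZMod p) = (-4) ^ j * (n.choose j : ZMod p) := by
  induction j with
  | zero => simp
  | succ j ih =>
    have ih := ih (by omega)
    have h0 : ((j + 1 : ℕ) : ZMod p) ≠ 0 := by
      rw [Ne, ZMod.natCast_eq_zero_iff]
      exact fun h => absurd (Nat.le_of_dvd (by omega) h) (by omega)
    have hp0 : (2 * n + 1 : ZMod p) = 0 := by
      have h := ZMod.natCast_self p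
      conv at h => enter [1, 1]; rw [hn]
      exact_mod_cast h
    have h1 : ((j + 1 : ℕ) : ZMod p) * (Nat.choose (2 * (j + 1)) (j + 1) : ZMod p)
        = 2 * (2 * j + 1) * (Nat.choose (2 * j) j : ZMod p) := by
      have h := Nat.succ_mul_centralBinom_succ j
      simp only [Nat.centralBinom] at h
      exact_mod_cast congrArg (Nat.cast : ℕ → ZMod p) h
    have h2 : (n.choose (j + 1) : ZMod p) * ((j + 1 : ℕ) : ZMod p)
        = (n.choose j : ZMod p) * (n - j) := by
      have h := congrArg (Nat.cast : ℕ → ZMod p) (Nat.choose_succ_right_eq n j)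
      rw [Nat.cast_mul, Nat.cast_mul, Nat.cast_sub (by omega : j ≤ n)] at h
      exact h
    apply mul_left_cancel₀ h0
    rw [h1, ih, pow_succ]
    linear_combination (4 * (-4) ^ j) * h2 + 2 * (-4) ^ j * (n.choose j : ZMod p) * hp0

theorem choose_two_mul_div_four_pow (p n : ℕ) [Fact p.Prime] (hn : p = 2 * n + 1)
    (j : ℕ) (hj : j ≤ n) (hj2 : Even j) :
    (Nat.choose (2 * j) j : ZMod p) / 4 ^ j = (n.choose j : ZMod p) := by
  have h2 : (2 : ZMod p) ≠ 0 := by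
    have hp := (Fact.out : p.Prime).two_le
    have h : ((2 : ℕ) : ZMod p) ≠ 0 := by
      rw [Ne, ZMod.natCast_eq_zero_iff]
      exact fun h => absurd (Nat.le_of_dvd (by omega) h) (by omega)
    exact_mod_cast h
  have h4 : (4 : ZMod p) ≠ 0 := by
    rw [show (4 : ZMod p) = 2 * 2 by norm_num]
    exact mul_ne_zero h2 h2
  rw [centralBinom_eq_neg_four_pow_mul_choose p n hn j hj, hj2.neg_pow]
  field_simp

theorem exists_isPrimitiveRoot_zmod (p d : ℕ) [Fact p.Prime] (hd : d ∣ p - 1) :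
    ∃ z : ZMod p, IsPrimitiveRoot z d := by
  obtain ⟨e, he⟩ := hd
  obtain ⟨g, hg⟩ := IsCyclic.exists_ofOrder_eq_natCard (α := (ZMod p)ˣ)
  have hp := (Fact.out : p.Prime).two_le
  rw [Nat.card_eq_fintype_card, ZMod.card_units] at hg
  have h := (IsPrimitiveRoot.orderOf g).pow (by omega) (a := e) (b := d) (by rw [hg, he, mul_comm])
  exact ⟨_, IsPrimitiveRoot.coe_units_iff.2 h⟩

theorem sum_pow_mul_of_isPrimitiveRoot {K : Type*} [Field K] {z : K} {d : ℕ}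
    (hz : IsPrimitiveRoot z d) (j : ℕ) :
    ∑ a ∈ Finset.range d, (z ^ a) ^ j = if d ∣ j then (d : K) else 0 := by
  simp_rw [fun a => pow_right_comm z a j]
  split_ifs with h
  · simp [(hz.pow_eq_one_iff_dvd j).2 h]
  · have h1 : z ^ j - 1 ≠ 0 := fun h0 => h ((hz.pow_eq_one_iff_dvd j).1 (sub_eq_zero.1 h0))
    apply (mul_eq_zero.1 _).resolve_left h1
    rw [mul_geom_sum, pow_right_comm, hz.pow_eq_one, one_pow, sub_self]

theorem sum_one_add_pow_of_isPrimitiveRoot {K : Type*} [Field K] {z : K} {d : ℕ}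
    (hz : IsPrimitiveRoot z d) (n : ℕ) :
    ∑ a ∈ Finset.range d, (1 + z ^ a) ^ n
      = d * ∑ j ∈ Finset.range (n + 1), if d ∣ j then (n.choose j : K) else 0 := by
  simp_rw [add_comm (1 : K), add_pow, one_pow, mul_one]
  rw [Finset.sum_comm, Finset.mul_sum]
  refine Finset.sum_congr rfl fun j _ => ?_
  rw [← Finset.sum_mul, sum_pow_mul_of_isPrimitiveRoot hz]
  split_ifs <;> simp

theorem sum_range_ite_dvd {M : Type*} [AddCommMonoid M] (f : ℕ → M) {d n : ℕ} (hd : 0 < d) :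
    (∑ j ∈ Finset.range (n + 1), if d ∣ j then f j else 0)
      = ∑ k ∈ Finset.range (n / d + 1), f (d * k) := by
  rw [← Finset.sum_filter]
  symm
  refine Finset.sum_nbij (d * ·) ?_ ?_ ?_ fun _ _ => rfl
  · intro k hk
    simp only [Finset.mem_range, Finset.mem_filter, Nat.lt_succ_iff] at hk ⊢
    exact ⟨(Nat.mul_le_mul_left d hk).trans (Nat.mul_div_le n d), dvd_mul_right _ _⟩
  · exact fun _ _ _ _ h => Nat.eq_of_mul_eq_mul_left hd h
  · intro j hj
    simp only [Finset.coe_filter, Finset.mem_range, Set.mem_ofPred_eq, Nat.lt_succ_iff] at hj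
    obtain ⟨hj, k, rfl⟩ := hj
    refine ⟨k, ?_, rfl⟩
    simp only [Finset.coe_range, Set.mem_Iio, Nat.lt_succ_iff]
    exact (Nat.le_div_iff_mul_le hd).2 (by rwa [mul_comm])

theorem two_pow_half_eq_neg_one (p : ℕ) [Fact p.Prime] (hp : p % 8 = 5) :
    (2 : ZMod p) ^ (p / 2) = -1 := by
  have h2 : (2 : ZMod p) ≠ 0 := by
    have h : ((2 : ℕ) : ZMod p) ≠ 0 := by
      rw [Ne, ZMod.natCast_eq_zero_iff]
      exact fun h => absurd (Nat.le_of_dvd (by omega) h) (by omega)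
    exact_mod_cast h
  refine (ZMod.pow_div_two_eq_neg_one_or_one p h2).resolve_left fun h => ?_
  have h3 := (ZMod.exists_sq_eq_two_iff (p := p) (by omega)).1 ((ZMod.euler_criterion p h2).2 h)
  omega

theorem sum_one_add_pow_twelfth_roots {K : Type*} [Field K] {z : K} (hz : IsPrimitiveRoot z 12)
    (m : ℕ) : ∑ a ∈ Finset.range 12, (1 + z ^ a) ^ (12 * m + 6)
      = 2 ^ (12 * m + 6) + 2 - 2 * 3 ^ (6 * m + 3) := by
  have h6 : z ^ 6 = -1 :=
    (hz.pow (by norm_num) (show 12 = 6 * 2 by norm_num)).eq_neg_one_of_two_right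
  have h4 : z ^ 4 - z ^ 2 + 1 = 0 := by
    have hne : z ^ 2 + 1 ≠ 0 := fun h => by
      have h1 : z ^ 4 = 1 := by linear_combination (z ^ 2 - 1) * h
      exact absurd ((hz.pow_eq_one_iff_dvd 4).1 h1) (by norm_num)
    apply (mul_eq_zero.1 _).resolve_left hne
    linear_combination h6
  have hzn : z ^ (12 * m + 6) = -1 := by
    rw [pow_add, pow_mul, hz.pow_eq_one, one_pow, one_mul, h6]
  have hodd : ∀ a b : ℕ, a + b = 12 → Odd a →
      (1 + z ^ a) ^ (12 * m + 6) + (1 + z ^ b) ^ (12 * m + 6) = 0 := by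
    intro a b hab ha
    have h : 1 + z ^ a = z ^ a * (1 + z ^ b) := by
      rw [mul_add, ← pow_add, hab, hz.pow_eq_one]; ring
    rw [h, mul_pow, pow_right_comm, hzn, ha.neg_one_pow]; ring
  have hsqrt : ∀ y s : K, y ^ (12 * m + 6) = -1 → s ^ 2 = 3 →
      (y * s) ^ (12 * m + 6) = -3 ^ (6 * m + 3) := by
    intro y s hy hs
    rw [mul_pow, hy, show 12 * m + 6 = 2 * (6 * m + 3) by ring, pow_mul, hs]; ring
  have e1 := hodd 1 11 rfl (by decide)
  have e3 := hodd 3 9 rfl (by decide)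
  have e5 := hodd 5 7 rfl (by decide)
  have hs : (2 * z - z ^ 3) ^ 2 = 3 := by
    linear_combination (z ^ 2 - 3) * h4
  have e2 : (1 + z ^ 2) ^ (12 * m + 6) = -3 ^ (6 * m + 3) := by
    rw [← hsqrt z _ hzn hs]
    congr 1
    linear_combination h4
  have e10 : (1 + z ^ 10) ^ (12 * m + 6) = -3 ^ (6 * m + 3) := by
    rw [← hsqrt (z ^ 11) _ (by rw [pow_right_comm, hzn]; norm_num) hs]
    congr 1
    linear_combination (z ^ 4 - 2 * (z ^ 6 - 1) + z ^ 2 * (z ^ 6 - 1)) * h6 - h4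
  have e4 : (1 + z ^ 4) ^ (12 * m + 6) = 1 := by
    rw [show 1 + z ^ 4 = z ^ 2 by linear_combination h4, pow_right_comm, hzn]; norm_num
  have e8 : (1 + z ^ 8) ^ (12 * m + 6) = 1 := by
    rw [show 1 + z ^ 8 = z ^ 10 by
      linear_combination (z ^ 2 - z ^ 4) * h6 + h4, pow_right_comm, hzn]; norm_num
  have e6 : (1 + z ^ 6) ^ (12 * m + 6) = 0 := by
    rw [h6, add_neg_cancel, zero_pow (by omega)]
  simp only [Finset.sum_range_succ, Finset.sum_range_zero, pow_zero, e2, e4, e6, e8, e10]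
  rw [one_add_one_eq_two]
  linear_combination e1 + e3 + e5

theorem sum_choose_mul_neg_one_pow_eq_zero {R : Type*} [CommRing R] [IsDomain R]
    (h2 : (2 : R) ≠ 0) (d m : ℕ) (hm : Odd m) :
    ∑ k ∈ Finset.range (m + 1), ((d * m).choose (d * k) : R) * (-1) ^ k = 0 := by
  have h : ∑ k ∈ Finset.range (m + 1), ((d * m).choose (d * k) : R) * (-1) ^ k
      = -∑ k ∈ Finset.range (m + 1), ((d * m).choose (d * k) : R) * (-1) ^ k := by
    conv_lhs => rw [← Finset.sum_range_reflect]
    rw [← Finset.sum_neg_distrib]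
    refine Finset.sum_congr rfl fun k hk => ?_
    have hk : k ≤ m := Nat.lt_succ_iff.1 (Finset.mem_range.1 hk)
    have hs : (-1 : R) ^ (m - k) * (-1) ^ k = -1 := by
      rw [← pow_add, Nat.sub_add_cancel hk, hm.neg_one_pow]
    have hk2 : (-1 : R) ^ k * (-1) ^ k = 1 := by rw [← mul_pow]; simp
    rw [show m + 1 - 1 - k = m - k by omega, Nat.mul_sub,
      Nat.choose_symm (Nat.mul_le_mul_left d hk)]
    linear_combination ((d * m).choose (d * k) : R) * ((-1) ^ k * hs - (-1) ^ (m - k) * hk2)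
  apply (mul_eq_zero.1 _).resolve_left h2
  linear_combination h

theorem stmt19 (p : ℕ) [Fact p.Prime] (hp : p % 24 = 13) :
    ((∑ k ∈ Finset.range ((p - 13) / 24 + 1),
        (Nat.choose (24 * k) (12 * k) : ZMod p) / 4 ^ (12 * k))
      = (1 / 12) * (1 - 2 * 3 ^ ((p - 1) / 4))) ∧
    ((∑ k ∈ Finset.range ((p - 1) / 12 + 1),
        (Nat.choose (12 * k) (6 * k) : ZMod p) * (-1 : ZMod p) ^ k / 4 ^ (6 * k))
      = 0) := by
  obtain ⟨m, hm⟩ : ∃ m, p = 24 * m + 13 := ⟨p / 24, by omega⟩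
  have hn : p = 2 * (12 * m + 6) + 1 := by omega
  have h12 : (12 : ZMod p) ≠ 0 := by
    have h : ((12 : ℕ) : ZMod p) ≠ 0 := by
      rw [Ne, ZMod.natCast_eq_zero_iff]
      exact fun h => absurd (Nat.le_of_dvd (by omega) h) (by omega)
    exact_mod_cast h
  constructor
  · obtain ⟨z, hz⟩ := exists_isPrimitiveRoot_zmod p 12 (by omega)
    have h2 := two_pow_half_eq_neg_one p (by omega)
    rw [show p / 2 = 12 * m + 6 by omega] at h2
    have h := sum_one_add_pow_of_isPrimitiveRoot hz (12 * m + 6)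
    rw [sum_one_add_pow_twelfth_roots hz, h2, sum_range_ite_dvd _ (by norm_num),
      show (12 * m + 6) / 12 = m by omega] at h
    rw [show (p - 13) / 24 = m by omega, show (p - 1) / 4 = 6 * m + 3 by omega]
    have hsum : ∑ k ∈ Finset.range (m + 1),
        (Nat.choose (24 * k) (12 * k) : ZMod p) / 4 ^ (12 * k)
        = ∑ k ∈ Finset.range (m + 1), ((12 * m + 6).choose (12 * k) : ZMod p) := by
      refine Finset.sum_congr rfl fun k hk => ?_
      have hk := Finset.mem_range.1 hk
      rw [← choose_two_mul_div_four_pow p _ hn (12 * k) (by omega) ⟨6 * k, by ring⟩,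
        ← mul_assoc]
      norm_num
    rw [hsum]
    apply mul_left_cancel₀ h12
    rw [← mul_assoc, mul_one_div_cancel h12]
    push_cast at h
    linear_combination -h
  · rw [show (p - 1) / 12 = 2 * m + 1 by omega]
    have h2 : (2 : ZMod p) ≠ 0 := fun h => h12 (by linear_combination 6 * h)
    rw [← sum_choose_mul_neg_one_pow_eq_zero h2 6 (2 * m + 1) ⟨m, rfl⟩]
    refine Finset.sum_congr rfl fun k hk => ?_
    have hk := Finset.mem_range.1 hk
    rw [show 6 * (2 * m + 1) = 12 * m + 6 by ring,
      ← choose_two_mul_div_four_pow p _ hn (6 * k) (by omega) ⟨3 * k, by ring⟩,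
      ← mul_assoc, div_mul_eq_mul_div]
    norm_num
end
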